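/- Let K be a number field of degree n ≥ 46369 that is abelian over ℚ (i.e., Galois over ℚ with abelian Galois group). Then log|d_K| − r₁(K)·π/2 − n·(log(8π) + γ) > 0; in particular log|d_K| ≠ r₁(K)·π/2 + n·(log(8π)+γ). (Combined with Ram Murty's bound log|d_K| ≥ (n log n)/2 for abelian fields, this shows ζ_K'(1/2) = 0 if and only if ζ_K(1/2) = 0 for abelian fields of degree at least 46369.) -/

import Mathlib

section
/-- Abstract discretely valued field with perfect residue field of characteristic `p`. -/
structure LD (M : Type*) [Field M] (Γ : Type*) [LinearOrderedCommGroupWithZero Γ] (p : ℕ) where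
  v : Valuation M Γ
  ϖ : M
  e : ℕ
  f : ℕ
  ne : ϖ ≠ 0
  lt : v ϖ < 1
  disc : ∀ x, x ≠ 0 → ∃ m : ℤ, v x = v ϖ ^ m
  vp : v (p : M) = v ϖ ^ e
  he : 0 < e
  hf : 0 < f
  frob : ∀ x, v x ≤ 1 → v (x ^ (p ^ f) - x) < 1

namespace LD

variable {M : Type*} [Field M] {Γ : Type*} [LinearOrderedCommGroupWithZero Γ] {p : ℕ}
  (D : LD M Γ p)

/-- value of the uniformizer -/
def q : Γ := D.v D.ϖ

lemma q_ne : D.q ≠ 0 := (Valuation.ne_zero_iff _).2 D.ne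
lemma q_pos : 0 < D.q := zero_lt_iff.2 D.q_ne
lemma q_lt : D.q < 1 := D.lt

lemma pow_le {m n : ℕ} : D.q ^ m ≤ D.q ^ n ↔ n ≤ m :=
  pow_le_pow_iff_right_of_lt_one₀ D.q_pos D.q_lt
lemma pow_lt {m n : ℕ} : D.q ^ m < D.q ^ n ↔ n < m :=
  pow_lt_pow_iff_right_of_lt_one₀ D.q_pos D.q_lt
lemma pow_inj {m n : ℕ} : D.q ^ m = D.q ^ n ↔ m = n := by
  constructor
  · intro h
    exact le_antisymm (D.pow_le.1 h.ge) (D.pow_le.1 h.le)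
  · rintro rfl; rfl

/-- `x` lies in the `m`-th power of the maximal ideal -/
def V (m : ℕ) (x : M) : Prop := D.v x ≤ D.q ^ m

variable {D}

lemma V.mono {m n : ℕ} {x : M} (h : D.V m x) (hn : n ≤ m) : D.V n x :=
  le_trans h (D.pow_le.2 hn)
lemma V.add {m : ℕ} {x y : M} (h : D.V m x) (h' : D.V m y) : D.V m (x + y) :=
  Valuation.map_add_le _ h h'
lemma V.sub {m : ℕ} {x y : M} (h : D.V m x) (h' : D.V m y) : D.V m (x - y) :=
  Valuation.map_sub_le _ h h'
lemma V.neg {m : ℕ} {x : M} (h : D.V m x) : D.V m (-x) := by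
  unfold V at *; rwa [Valuation.map_neg]
lemma V.mul {m n : ℕ} {x y : M} (h : D.V m x) (h' : D.V n y) : D.V (m + n) (x * y) := by
  unfold V at *; rw [map_mul, pow_add]; exact mul_le_mul' h h'
lemma V.pow {m : ℕ} {x : M} (h : D.V m x) (n : ℕ) : D.V (m * n) (x ^ n) := by
  unfold V at *; rw [map_pow, pow_mul]; exact pow_le_pow_left' h n
lemma V.sum {m : ℕ} {ι : Type*} {s : Finset ι} {g : ι → M} (h : ∀ i ∈ s, D.V m (g i)) :
    D.V m (∑ i ∈ s, g i) := Valuation.map_sum_le _ h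
lemma V.prod0 {ι : Type*} {s : Finset ι} {g : ι → M} (h : ∀ i ∈ s, D.V 0 (g i)) :
    D.V 0 (∏ i ∈ s, g i) := by
  classical
  induction s using Finset.induction_on with
  | empty => simp [V]
  | insert a s ha ih =>
    rw [Finset.prod_insert ha]
    exact (h a (by simp)).mul (ih fun i hi => h i (by simp [hi]))

variable (D)

lemma V_zero {m : ℕ} : D.V m (0 : M) := by simp [V]
lemma V_pi : D.V 1 D.ϖ := by simp [V, q]
lemma V_p : D.V D.e (p : M) := by unfold V; rw [D.vp]; rfl
lemma V_nat (n : ℕ) : D.V 0 (n : M) := by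
  induction n with
  | zero => simpa using D.V_zero
  | succ k ih => push_cast; exact ih.add (by simp [V])
lemma V_int (n : ℤ) : D.V 0 (n : M) := by
  obtain ⟨k, rfl | rfl⟩ := n.eq_nat_or_neg
  · simpa using D.V_nat k
  · simpa using (D.V_nat k).neg
lemma V_of_dvd {n : ℕ} (h : p ∣ n) : D.V D.e (n : M) := by
  obtain ⟨k, rfl⟩ := h
  simpa using D.V_p.mul (D.V_nat k)

lemma V0_iff {x : M} : D.V 0 x ↔ D.v x ≤ 1 := by simp [V]

lemma exists_pow {x : M} (hx : x ≠ 0) (h : D.V 0 x) : ∃ m : ℕ, D.v x = D.q ^ m := by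
  obtain ⟨m, hm⟩ := D.disc x hx
  have h1 : D.v x ≤ 1 := D.V0_iff.1 h
  rcases le_or_gt 0 m with h0 | h0
  · lift m to ℕ using h0
    exact ⟨m, by simpa [q] using hm⟩
  · exfalso
    have := one_lt_zpow_of_neg₀ D.q_pos D.q_lt h0
    rw [hm] at h1
    exact absurd h1 (not_le.2 this)

lemma V_succ {x : M} {m : ℕ} (h : D.v x < D.q ^ m) : D.V (m + 1) x := by
  by_cases hx : x = 0
  · subst hx; exact D.V_zero
  obtain ⟨k, hk⟩ := D.exists_pow hx (V.mono (D := D) (m := m) h.le (Nat.zero_le _))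
  unfold V
  rw [hk] at h ⊢
  rw [D.pow_lt] at h
  rw [D.pow_le]; omega

lemma V1_iff {x : M} : D.V 1 x ↔ D.v x < 1 := by
  constructor
  · intro h
    refine lt_of_le_of_lt h ?_
    simpa using D.q_lt
  · intro h; simpa using D.V_succ (m := 0) (by simpa using h)

lemma not_V_of_eq {x : M} {m k : ℕ} (h : D.v x = D.q ^ m) (hk : m < k) : ¬ D.V k x := by
  unfold V; rw [h, D.pow_le]; omega

lemma V_of_eq {x : M} {m k : ℕ} (h : D.v x = D.q ^ m) (hk : k ≤ m) : D.V k x := by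
  unfold V; rw [h, D.pow_le]; omega

lemma eq_of_V {x : M} {m : ℕ} (h : D.V m x) (h' : ¬ D.V (m + 1) x) : D.v x = D.q ^ m := by
  by_contra hne
  exact h' (D.V_succ (lt_of_le_of_ne h hne))

/-- perturbation -/
lemma eq_of_sub {x y : M} {m : ℕ} (h : D.v x = D.q ^ m) (h' : D.V (m + 1) (y - x)) :
    D.v y = D.q ^ m := by
  have : D.v (y - x) < D.v x := by
    rw [h]; exact lt_of_le_of_lt h' (D.pow_lt.2 (Nat.lt_succ_self m))
  have h2 := Valuation.map_add_eq_of_lt_left (v := D.v) this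
  simpa [h] using h2

lemma V_div {x y : M} {m k : ℕ} (hy : D.v y = D.q ^ m) (hx : D.V (m + k) x) : D.V k (x / y) := by
  unfold V at *
  rw [map_div₀, hy, div_le_iff₀ (pow_pos D.q_pos m), ← pow_add, add_comm]; exact hx

lemma V_cancel {x y : M} {m k : ℕ} (hy : D.v y = D.q ^ m) (hx : D.V (m + k) (y * x)) : D.V k x := by
  have hy0 : y ≠ 0 := by
    rintro rfl
    simp at hy
    exact pow_ne_zero _ D.q_ne hy.symm
  have := D.V_div hy hx
  rwa [mul_div_cancel_left₀ _ hy0] at this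

lemma eq_zero_of_V {x : M} (h : ∀ m, D.V m x) : x = 0 := by
  by_contra hx
  obtain ⟨k, hk⟩ := D.exists_pow hx (h 0)
  exact D.not_V_of_eq hk (Nat.lt_succ_self k) (h _)

lemma v_nat [hp : Fact p.Prime] {n : ℕ} (h : ¬ p ∣ n) : D.v (n : M) = 1 := by
  have h1 : D.v (n : M) ≤ 1 := D.V0_iff.1 (D.V_nat n)
  refine le_antisymm h1 ?_
  by_contra hlt
  push Not at hlt
  have hV : D.V 1 (n : M) := D.V1_iff.2 hlt
  have hcop : IsCoprime (n : ℤ) (p : ℤ) :=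
    (Nat.isCoprime_iff_coprime).2 ((Nat.Prime.coprime_iff_not_dvd hp.out).2 h).symm
  obtain ⟨a, b, hab⟩ := hcop
  have : D.V 1 ((1 : ℤ) : M) := by
    rw [← hab]; push_cast
    have e1 := (D.V_int a).mul hV
    have e2 := (D.V_int b).mul (D.V_p.mono D.he)
    exact (e1.mono (by omega)).add (e2.mono (by omega))
  rw [Int.cast_one, D.V1_iff, map_one] at this
  exact lt_irrefl _ this

end LD

end

section
namespace LD

variable {M : Type*} [Field M] {Γ : Type*} [LinearOrderedCommGroupWithZero Γ] {p : ℕ}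
  (D : LD M Γ p)

/-- isometry -/
def Iso (σ : RingAut M) : Prop := ∀ x, D.v (σ x) = D.v x

/-- ramification group condition -/
def In (σ : RingAut M) (s : ℕ) : Prop := ∀ x, D.V 0 x → D.V (s + 1) (σ x - x)

/-- `σ` is inertial with break exactly `t` -/
def Brk (σ : RingAut M) (t : ℕ) : Prop :=
  D.Iso σ ∧ D.In σ 0 ∧ D.v (σ D.ϖ - D.ϖ) = D.q ^ (t + 1)

variable {D}

lemma Iso.V {σ : RingAut M} (h : D.Iso σ) {m : ℕ} {x : M} : D.V m (σ x) ↔ D.V m x := by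
  unfold LD.V; rw [h x]

lemma Iso.mul {σ τ : RingAut M} (h : D.Iso σ) (h' : D.Iso τ) : D.Iso (σ * τ) := by
  intro x; rw [RingAut.mul_apply, h, h']

lemma Iso.one : D.Iso (1 : RingAut M) := fun _ => rfl

lemma Iso.pow {σ : RingAut M} (h : D.Iso σ) (n : ℕ) : D.Iso (σ ^ n) := by
  induction n with
  | zero => simpa using Iso.one
  | succ k ih => rw [pow_succ]; exact ih.mul h

lemma Iso.inv {σ : RingAut M} (h : D.Iso σ) : D.Iso σ⁻¹ := by
  intro x
  have := h (σ⁻¹ x)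
  rw [← RingAut.mul_apply, mul_inv_cancel] at this
  exact this.symm

lemma In.mul {σ τ : RingAut M} {s : ℕ} (hi : D.Iso τ) (h : D.In σ s) (h' : D.In τ s) :
    D.In (σ * τ) s := by
  intro x hx
  have e1 := h (τ x) (hi.V.2 hx)
  have e2 := h' x hx
  have := e1.add e2
  rwa [sub_add_sub_cancel] at this

lemma In.one {s : ℕ} : D.In (1 : RingAut M) s := by
  intro x _
  simpa using D.V_zero

lemma In.pow {σ : RingAut M} {s : ℕ} (hi : D.Iso σ) (h : D.In σ s) (n : ℕ) :
    D.In (σ ^ n) s := by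
  induction n with
  | zero => simpa using In.one
  | succ k ih => rw [pow_succ]; exact In.mul hi ih h

lemma In.inv {σ : RingAut M} {s : ℕ} (hi : D.Iso σ) (h : D.In σ s) : D.In σ⁻¹ s := by
  intro x hx
  have := h (σ⁻¹ x) (hi.inv.V.2 hx)
  rw [← RingAut.mul_apply, mul_inv_cancel] at this
  have := this.neg
  rwa [neg_sub] at this

lemma In.mono {σ : RingAut M} {s s' : ℕ} (h : D.In σ s) (hs : s' ≤ s) : D.In σ s' :=
  fun x hx => (h x hx).mono (by omega)

variable (D)

lemma pow_p_diff [hp : Fact p.Prime] {z d : M} {k : ℕ} (hz : D.V 0 z) (hd : D.V (k + 1) d) :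
    D.V (k + 2) ((z + d) ^ p - z ^ p) := by
  have hz' : z ∈ D.v.integer := D.V0_iff.1 hz
  have hd' : d ∈ D.v.integer := D.V0_iff.1 (hd.mono (Nat.zero_le _))
  obtain ⟨r, hr⟩ := exists_add_pow_prime_eq hp.out (⟨z, hz'⟩ : D.v.integer) ⟨d, hd'⟩
  have hr' := congrArg (Subtype.val) hr
  push_cast at hr'
  have hrV : D.V 0 (r : M) := D.V0_iff.2 r.2
  rw [hr']
  have e1 : D.V (k + 2) (d ^ p) := (hd.pow p).mono (by nlinarith [hp.out.two_le])
  have e2 : D.V (k + 2) ((p : M) * z * d * r) :=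
    (((D.V_p.mul hz).mul hd).mul hrV).mono (by have := D.he; omega)
  have := e1.add e2
  convert this using 1
  ring

lemma In_of_pi [hp : Fact p.Prime] {σ : RingAut M} (hσ : D.Iso σ) {s : ℕ} (h0 : D.In σ 0)
    (hs : D.V (s + 1) (σ D.ϖ - D.ϖ)) : ∀ k ≤ s, D.In σ k := by
  intro k
  induction k with
  | zero => intro _; exact h0
  | succ k ih =>
    intro hk x hx
    have hIn := ih (by omega)
    set z := x ^ (p ^ (D.f - 1)) with hz
    have hzV : D.V 0 z := by simpa using hx.pow (p ^ (D.f - 1))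
    have hzp : z ^ p = x ^ (p ^ D.f) := by
      rw [hz, ← pow_mul, ← pow_succ, Nat.sub_add_cancel D.hf]
    have hfr : D.V 1 (x - z ^ p) := by
      have := D.V1_iff.2 (D.frob x (D.V0_iff.1 hx))
      rw [hzp]; simpa using this.neg
    set w := (x - z ^ p) / D.ϖ with hw
    have hwV : D.V 0 w := D.V_div (m := 1) (by simp [q]) hfr
    have hx' : x = z ^ p + D.ϖ * w := by
      rw [hw, mul_div_cancel₀ _ D.ne]; ring
    have hd := D.pow_p_diff hzV (hIn z hzV)
    have h2 := hs.mul (hσ.V.2 hwV)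
    have h3 := D.V_pi.mul (hIn w hwV)
    have : σ x - x = ((z + (σ z - z)) ^ p - z ^ p) + (σ D.ϖ - D.ϖ) * σ w + D.ϖ * (σ w - w) := by
      conv_lhs => rw [hx']
      simp only [map_add, map_mul, map_pow]
      ring
    rw [this]
    exact (hd.add (h2.mono (by omega))).add (h3.mono (by omega))

lemma eq_one_of_pi [hp : Fact p.Prime] {σ : RingAut M} (hσ : D.Iso σ) (h0 : D.In σ 0)
    (h : σ D.ϖ = D.ϖ) : σ = 1 := by
  have key : ∀ x, D.V 0 x → σ x = x := by
    intro x hx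
    rw [← sub_eq_zero]
    apply D.eq_zero_of_V
    intro m
    exact (D.In_of_pi hσ (s := m) h0 (by rw [h, sub_self]; exact D.V_zero) m le_rfl x hx).mono
      (by omega)
  ext x
  show σ x = x
  rcases le_total (D.v x) 1 with h1 | h1
  · exact key x (D.V0_iff.2 h1)
  · by_cases hx : x = 0
    · simp [hx]
    have : D.V 0 x⁻¹ := by rw [D.V0_iff, map_inv₀]; exact inv_le_one_of_one_le₀ h1
    have := key _ this
    rw [map_inv₀] at this
    exact inv_injective this

lemma exists_brk [hp : Fact p.Prime] {σ : RingAut M} (hσ : D.Iso σ) (h0 : D.In σ 0)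
    (h : σ ≠ 1) : ∃ t, D.Brk σ t := by
  have hne : σ D.ϖ - D.ϖ ≠ 0 := fun h' => h (D.eq_one_of_pi hσ h0 (sub_eq_zero.1 h'))
  have h1 := h0 D.ϖ (D.V_pi.mono (by omega))
  obtain ⟨m, hm⟩ := D.exists_pow hne (h1.mono (by omega))
  have : 1 ≤ m := by
    unfold LD.V at h1
    rw [hm, D.pow_le] at h1; omega
  exact ⟨m - 1, hσ, h0, by rw [hm]; congr 1; omega⟩

variable {D}

lemma Brk.In [hp : Fact p.Prime] {σ : RingAut M} {t : ℕ} (h : D.Brk σ t) : D.In σ t :=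
  D.In_of_pi h.1 h.2.1 h.2.2.le t le_rfl

lemma Brk.ne_one {σ : RingAut M} {t : ℕ} (h : D.Brk σ t) : σ ≠ 1 := by
  rintro rfl
  have := h.2.2
  simp at this
  exact pow_ne_zero _ D.q_ne this.symm

lemma Brk.le_of_In {σ : RingAut M} {t s : ℕ} (h : D.Brk σ t) (h' : D.In σ s) : s ≤ t := by
  have := h' D.ϖ (D.V_pi.mono (by omega))
  unfold LD.V at this
  rw [h.2.2, D.pow_le] at this; omega

lemma Brk.unique {σ : RingAut M} {t s : ℕ} (h : D.Brk σ t) (h' : D.Brk σ s) : s = t := by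
  have := h.2.2.symm.trans h'.2.2
  rw [D.pow_inj] at this; omega

/-- the ratio `σϖ/ϖ - 1` -/
def ra (D : LD M Γ p) (σ : RingAut M) : M := (σ D.ϖ - D.ϖ) / D.ϖ

lemma sigma_pi (σ : RingAut M) : σ D.ϖ = D.ϖ * (1 + D.ra σ) := by
  unfold ra; field_simp [D.ne]; ring

lemma Brk.v_ra {σ : RingAut M} {t : ℕ} (h : D.Brk σ t) : D.v (D.ra σ) = D.q ^ t := by
  unfold ra
  rw [map_div₀, h.2.2, pow_succ]
  exact mul_div_cancel_right₀ _ D.q_ne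

lemma one_add_pow_V {a : M} {t : ℕ} (ha : D.V t a) (m : ℕ) :
    D.V (2 * t) ((1 + a) ^ m - 1 - m * a) := by
  have h0 : D.V 0 (1 + a) := V.add (by simp [LD.V]) (ha.mono (by omega))
  induction m with
  | zero => simpa using D.V_zero
  | succ m ih =>
    have e1 := h0.mul ih
    have e2 := (D.V_nat m).mul (ha.mul ha)
    have := (e1.mono (by omega : 2 * t ≤ _)).add (e2.mono (by omega : 2 * t ≤ _))
    convert this using 1
    push_cast
    ring

lemma Brk.dl [hp : Fact p.Prime] {σ : RingAut M} {t : ℕ} (h : D.Brk σ t) (ht : 1 ≤ t)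
    {x : M} {m : ℕ} (hx : D.v x = D.q ^ m) :
    D.V (m + t + 1) (σ x - x - m * D.ra σ * x) := by
  set a := D.ra σ with ha
  have haV : D.V t a := h.v_ra.le
  set y := x / D.ϖ ^ m with hy
  have hpm : D.ϖ ^ m ≠ 0 := pow_ne_zero _ D.ne
  have hyV : D.V 0 y := by
    rw [D.V0_iff, hy, map_div₀, hx, map_pow]
    exact le_of_eq (div_self (pow_ne_zero _ D.q_ne))
  have hxy : x = D.ϖ ^ m * y := by rw [hy]; field_simp
  have hδ := h.In y hyV
  have h1a : D.V 0 ((1 + a) ^ m) := by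
    simpa using (V.add (m := 0) (D := D) (x := 1) (y := a) (by simp [LD.V])
      (haV.mono (by omega))).pow m
  have key : σ x - x - m * a * x = D.ϖ ^ m *
      ((1 + a) ^ m * (σ y - y) + ((1 + a) ^ m - 1 - m * a) * y) := by
    conv_lhs => rw [hxy]
    rw [map_mul, map_pow, sigma_pi, ← ha, mul_pow]
    ring
  rw [key]
  have hpi : D.V m (D.ϖ ^ m) := by simpa using D.V_pi.pow m
  have e1 := h1a.mul hδ
  have e2 := (one_add_pow_V haV m).mul hyV
  exact (hpi.mul ((e1.mono (by omega : t + 1 ≤ _)).add (e2.mono (by omega : t + 1 ≤ _)))).mono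
    (by omega)

lemma Brk.step [hp : Fact p.Prime] {σ : RingAut M} {t : ℕ} (h : D.Brk σ t) (ht : 1 ≤ t)
    {x : M} {m : ℕ} (hx : D.V m x) : D.V (m + t) (σ x - x) := by
  by_cases h0 : x = 0
  · subst h0; simpa using D.V_zero
  obtain ⟨k, hk⟩ := D.exists_pow h0 (hx.mono (Nat.zero_le _))
  have hmk : m ≤ k := by unfold LD.V at hx; rwa [hk, D.pow_le] at hx
  have e1 := h.dl ht hk
  have e2 : D.V (k + t) (k * D.ra σ * x) :=
    (((D.V_nat k).mul (h.v_ra.le : D.V t _)).mul (hk.le : D.V k x)).mono (by omega)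
  have := (e1.mono (by omega : m + t ≤ _)).add (e2.mono (by omega : m + t ≤ _))
  rwa [sub_add_cancel] at this

lemma Brk.dvd_of_fixed [hp : Fact p.Prime] {σ : RingAut M} {t : ℕ} (h : D.Brk σ t) (ht : 1 ≤ t)
    {x : M} {m : ℕ} (hx : D.v x = D.q ^ m) (hf : D.V (m + t + 1) (σ x - x)) : p ∣ m := by
  by_contra hd
  have e1 := h.dl ht hx
  have e2 := hf.sub e1
  rw [sub_sub_cancel] at e2
  have : D.v (m * D.ra σ * x) = D.q ^ (m + t) := by
    rw [map_mul, map_mul, D.v_nat hd, h.v_ra, hx, one_mul, ← pow_add, add_comm]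
  exact D.not_V_of_eq this (Nat.lt_succ_self _) e2

lemma Brk.pow_dl [hp : Fact p.Prime] {σ : RingAut M} {t : ℕ} (h : D.Brk σ t) (ht : 1 ≤ t)
    (l : ℕ) : D.V (t + 2) ((σ ^ l) D.ϖ - D.ϖ - l * D.ra σ * D.ϖ) := by
  induction l with
  | zero => simpa using D.V_zero
  | succ l ih =>
    set y := (σ ^ l) D.ϖ with hy
    have hvy : D.v y = D.q ^ 1 := by rw [hy, h.1.pow l]; simp [q]
    have e1 := h.dl ht hvy
    have e2 : D.V (t + 1) (y - D.ϖ) := (h.In.pow h.1 l) D.ϖ (D.V_pi.mono (by omega))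
    have e3 := V.mul (D := D) (m := t) h.v_ra.le e2
    have := (ih.add (e1.mono (by omega : t + 2 ≤ _))).add (e3.mono (by omega : t + 2 ≤ _))
    convert this using 1
    rw [pow_succ', RingAut.mul_apply, ← hy]
    push_cast
    ring

lemma Brk.pow [hp : Fact p.Prime] {σ : RingAut M} {t : ℕ} (h : D.Brk σ t) (ht : 1 ≤ t)
    {l : ℕ} (hl : ¬ p ∣ l) : D.Brk (σ ^ l) t := by
  refine ⟨h.1.pow l, h.2.1.pow h.1 l, ?_⟩
  have : D.v (l * D.ra σ * D.ϖ) = D.q ^ (t + 1) := by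
    rw [map_mul, map_mul, D.v_nat hl, h.v_ra, one_mul, pow_succ]; rfl
  exact D.eq_of_sub this (h.pow_dl ht l)

lemma Brk.powp_aux [hp : Fact p.Prime] {σ : RingAut M} {t : ℕ} (h : D.Brk σ t) (ht : 1 ≤ t) :
    ∃ r, D.V (p * t + 1) r ∧
      D.V (D.e + t + 2) ((σ ^ p) D.ϖ - D.ϖ - p * (σ D.ϖ - D.ϖ) - r) := by
  let S : Module.End ℤ M := (σ : M →+* M).toAddMonoidHom.toIntLinearMap
  have hS : ∀ n : ℕ, ∀ x, (S ^ n) x = (σ ^ n) x := by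
    intro n
    induction n with
    | zero => intro x; rfl
    | succ n ih => intro x; rw [pow_succ, pow_succ, Module.End.mul_apply, ih]; rfl
  set Δ : Module.End ℤ M := S - 1 with hΔ
  have hΔ1 : ∀ x, Δ x = σ x - x := fun x => rfl
  have hpw : ∀ i : ℕ, D.V (1 + i * t) ((Δ ^ i) D.ϖ) := by
    intro i
    induction i with
    | zero => simpa using D.V_pi
    | succ i ih =>
      rw [pow_succ', Module.End.mul_apply, hΔ1]
      have := h.step ht ih
      exact this.mono (by ring_nf; omega)
  have hexp : S ^ p = ∑ i ∈ Finset.range (p + 1), Δ ^ i * 1 ^ (p - i) * (p.choose i : Module.End ℤ M) := by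
    rw [← (Commute.one_right Δ).add_pow, hΔ, sub_add_cancel]
  have hexp' : (σ ^ p) D.ϖ = ∑ i ∈ Finset.range (p + 1), (p.choose i : M) * (Δ ^ i) D.ϖ := by
    rw [← hS, hexp, LinearMap.sum_apply]
    refine Finset.sum_congr rfl fun i _ => ?_
    rw [one_pow, mul_one, ← nsmul_eq_mul', ← nsmul_eq_mul]
    rfl
  have hp2 := hp.out.two_le
  refine ⟨(Δ ^ p) D.ϖ, (hpw p).mono (by omega), ?_⟩
  obtain ⟨n, hn⟩ : ∃ n, p = n + 2 := ⟨p - 2, by omega⟩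
  have hsplit : (σ ^ p) D.ϖ - D.ϖ - p * (σ D.ϖ - D.ϖ) - (Δ ^ p) D.ϖ =
      ∑ i ∈ Finset.range n, (p.choose (i + 2) : M) * (Δ ^ (i + 2)) D.ϖ := by
    have h2 : p + 1 = n + 1 + 1 + 1 := by omega
    rw [hexp', h2, Finset.sum_range_succ, Finset.sum_range_succ', Finset.sum_range_succ']
    have : n + 1 + 1 = p := by omega
    simp only [this, zero_add, Nat.choose_self, Nat.choose_zero_right, Nat.choose_one_right,
      pow_zero, pow_one, hΔ1, Module.End.one_apply]
    push_cast
    ring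
  rw [hsplit]
  refine V.sum fun i hi => ?_
  rw [Finset.mem_range] at hi
  have e1 := (D.V_of_dvd (hp.out.dvd_choose_self (k := i + 2) (by omega) (by omega))).mul
    (hpw (i + 2))
  exact e1.mono (by nlinarith)

lemma Brk.powp_big [hp : Fact p.Prime] {σ : RingAut M} {t : ℕ} (h : D.Brk σ t) (ht : 1 ≤ t)
    (hb : D.e < (p - 1) * t) : D.Brk (σ ^ p) (D.e + t) := by
  refine ⟨h.1.pow p, h.2.1.pow h.1 p, ?_⟩
  obtain ⟨r, hr, hr'⟩ := h.powp_aux ht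
  have hp1 := hp.out.one_le
  have hpt : (p - 1) * t + t = p * t := by
    rw [← Nat.succ_mul]; congr 1; omega
  have : D.v (p * (σ D.ϖ - D.ϖ)) = D.q ^ (D.e + t + 1) := by
    rw [map_mul, D.vp, h.2.2, add_assoc, pow_add D.q D.e]; rfl
  apply D.eq_of_sub this
  have := hr'.add (hr.mono (by omega : D.e + t + 2 ≤ _))
  rwa [sub_add_cancel] at this

lemma Brk.powp_small [hp : Fact p.Prime] {σ : RingAut M} {t : ℕ} (h : D.Brk σ t) (ht : 1 ≤ t)
    (hb : (p - 1) * t ≤ D.e) : D.V (p * t + 1) ((σ ^ p) D.ϖ - D.ϖ) := by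
  obtain ⟨r, hr, hr'⟩ := h.powp_aux ht
  have hp1 := hp.out.one_le
  have hpt : (p - 1) * t + t = p * t := by
    rw [← Nat.succ_mul]; congr 1; omega
  have e3 : D.V (D.e + (t + 1)) (p * (σ D.ϖ - D.ϖ)) := D.V_p.mul h.2.2.le
  have := ((hr'.mono (by omega : p * t + 1 ≤ _)).add hr).add (e3.mono (by omega : p * t + 1 ≤ _))
  convert this using 1
  ring

/-- finite order elements have small breaks -/
lemma Brk.le_e [hp : Fact p.Prime] {σ : RingAut M} {t : ℕ} (h : D.Brk σ t) (ht : 1 ≤ t)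
    (hfin : IsOfFinOrder σ) : (p - 1) * t ≤ D.e := by
  by_contra hb
  push Not at hb
  have key : ∀ k : ℕ, ∃ s, 1 ≤ s ∧ D.e < (p - 1) * s ∧ D.Brk (σ ^ (p ^ k)) s := by
    intro k
    induction k with
    | zero => exact ⟨t, ht, hb, by simpa using h⟩
    | succ k ih =>
      obtain ⟨s, hs, hs', hB⟩ := ih
      refine ⟨D.e + s, by omega, lt_of_lt_of_le hs' (Nat.mul_le_mul_left _ (by omega)), ?_⟩
      rw [pow_succ, pow_mul]
      exact hB.powp_big hs hs'
  obtain ⟨n, hn, hn1⟩ := isOfFinOrder_iff_pow_eq_one.1 hfin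
  obtain ⟨k, l, hl, rfl⟩ := Nat.exists_eq_pow_mul_and_not_dvd hn.ne' p hp.out.ne_one
  obtain ⟨s, hs, _, hB⟩ := key k
  rw [pow_mul] at hn1
  exact (hB.pow hs hl).ne_one hn1

lemma Brk.powp [hp : Fact p.Prime] {σ : RingAut M} {t s : ℕ} (h : D.Brk σ t) (ht : 1 ≤ t)
    (hfin : IsOfFinOrder σ) (h' : D.Brk (σ ^ p) s) : p * t ≤ s := by
  have := h.powp_small ht (h.le_e ht hfin)
  unfold LD.V at this
  rw [h'.2.2, D.pow_le] at this
  omega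

/-- commuting elements have congruent breaks -/
lemma Brk.congr [hp : Fact p.Prime] {σ τ : RingAut M} {s t : ℕ} (h : D.Brk σ s) (hs : 1 ≤ s)
    (h' : D.Brk τ t) (ht : 1 ≤ t) (hc : σ * τ = τ * σ) : (p : ℤ) ∣ (t : ℤ) - s := by
  set a := D.ra σ with ha
  set b := D.ra τ with hb
  have hcc : σ (τ D.ϖ) = τ (σ D.ϖ) := by
    rw [← RingAut.mul_apply, hc, RingAut.mul_apply]
  rw [sigma_pi, sigma_pi, map_mul, map_mul, sigma_pi, sigma_pi, map_add, map_add, map_one,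
    map_one, ← ha, ← hb, mul_assoc, mul_assoc] at hcc
  have hcc := mul_left_cancel₀ D.ne hcc
  have hid : (1 + a) * (σ b - b) = (1 + b) * (τ a - a) := by linear_combination hcc
  have haV : D.V s a := h.v_ra.le
  have hbV : D.V t b := h'.v_ra.le
  have e1 := h.dl hs h'.v_ra
  have e2 := h'.dl ht h.v_ra
  rw [← ha, ← hb] at e1 e2
  have f1 := h.step hs hbV
  have f2 := h'.step ht haV
  have g1 := haV.mul f1
  have g2 := hbV.mul f2
  have tot := ((((g2.mono (by omega : s + t + 1 ≤ _)).sub (g1.mono (by omega : s + t + 1 ≤ _))).add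
    (e2.mono (by omega : s + t + 1 ≤ _))).sub (e1.mono (by omega : s + t + 1 ≤ _)))
  have tot' : D.V (s + t + 1) ((((t : ℤ) - s : ℤ) : M) * (a * b)) := by
    convert tot using 1
    push_cast
    linear_combination hid
  by_contra hd
  have hnd : ¬ p ∣ ((t : ℤ) - s).natAbs := by
    rwa [← Int.natCast_dvd]
  have hv : D.v ((((t : ℤ) - s : ℤ) : M)) = 1 := by
    have := D.v_nat hnd
    rcases Int.natAbs_eq ((t : ℤ) - s) with h1 | h1
    · rw [h1, Int.cast_natCast]; exact this
    · rw [h1, Int.cast_neg, Int.cast_natCast, Valuation.map_neg]; exact this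
  have : D.v ((((t : ℤ) - s : ℤ) : M) * (a * b)) = D.q ^ (s + t) := by
    rw [map_mul, hv, one_mul, map_mul, h.v_ra, h'.v_ra, ← pow_add]
  exact D.not_V_of_eq this (Nat.lt_succ_self _) tot'

end LD

end

section
namespace LD

section Frob
variable {M : Type*} [Field M] {Γ : Type*} [LinearOrderedCommGroupWithZero Γ] {p : ℕ}
  {D : LD M Γ p}

/-- leading coefficient -/
def lc (D : LD M Γ p) (s : ℕ) (σ : RingAut M) : M := (σ D.ϖ - D.ϖ) / D.ϖ ^ (s + 1)

lemma In.lc_V {σ : RingAut M} {s : ℕ} (h : D.In σ s) : D.V 0 (D.lc s σ) := by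
  refine D.V_div (m := s + 1) (by simp [q]) ?_
  exact h D.ϖ (D.V_pi.mono (by omega))

lemma lc_frob {φ σ : RingAut M} {s : ℕ} (hφ : D.Iso φ) (hF : ∀ x, D.V 0 x → D.V 1 (φ x - x ^ p))
    (hσ : D.Iso σ) (h : D.In σ s) (hc : φ * σ = σ * φ) :
    D.V 1 ((D.lc s σ) ^ p - (D.ϖ / φ D.ϖ) ^ s * D.lc s σ) := by
  set c := D.lc s σ with hcd
  set u := φ D.ϖ / D.ϖ with hu
  have hφϖ : φ D.ϖ ≠ 0 := by simpa using D.ne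
  have hu0 : u ≠ 0 := div_ne_zero hφϖ D.ne
  have huv : D.v u = 1 := by
    rw [hu, map_div₀, hφ]; exact div_self D.q_ne
  have huϖ : φ D.ϖ = u * D.ϖ := by rw [hu, div_mul_cancel₀ _ D.ne]
  have hpi : D.ϖ ^ (s + 1) ≠ 0 := pow_ne_zero _ D.ne
  have hcom : φ (σ D.ϖ) = σ (φ D.ϖ) := by
    rw [← RingAut.mul_apply, hc, RingAut.mul_apply]
  have hcϖ : σ D.ϖ - D.ϖ = c * D.ϖ ^ (s + 1) := by
    rw [hcd]; unfold lc; rw [div_mul_cancel₀ _ hpi]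
  have h1 : φ c - (u ^ s)⁻¹ * c = (σ u - u) * σ D.ϖ * (u ^ (s+1))⁻¹ / D.ϖ ^ (s + 1) := by
    have e1 : φ c * (u * D.ϖ) ^ (s + 1) = σ u * σ D.ϖ - u * D.ϖ := by
      have := congrArg φ hcϖ
      rw [map_sub, map_mul, map_pow, hcom, huϖ, map_mul] at this
      exact this.symm
    have e2 : c * D.ϖ ^ (s + 1) = σ D.ϖ - D.ϖ := hcϖ.symm
    have hus : u ^ s ≠ 0 := pow_ne_zero _ hu0
    have hus1 : u ^ (s + 1) ≠ 0 := pow_ne_zero _ hu0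
    rw [eq_div_iff hpi, eq_mul_inv_iff_mul_eq₀ hus1]
    rw [mul_pow] at e1
    have : (u ^ s)⁻¹ * u ^ (s + 1) = u := by rw [pow_succ, inv_mul_cancel_left₀ hus]
    linear_combination e1 - u * e2 - (c * D.ϖ ^ (s + 1)) * this
  have hV : D.V 1 (φ c - (u ^ s)⁻¹ * c) := by
    rw [h1]
    refine D.V_div (m := s + 1) (by simp [q]) ?_
    have a1 : D.V (s + 1) (σ u - u) := h u (D.V0_iff.2 huv.le)
    have a2 : D.V 1 (σ D.ϖ) := hσ.V.2 D.V_pi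
    have a3 : D.V 0 ((u ^ (s + 1))⁻¹) := by
      rw [D.V0_iff, map_inv₀, map_pow, huv]; simp
    exact ((a1.mul a2).mul a3).mono (by omega)
  have hcV : D.V 0 c := h.lc_V
  have := hV.sub (hF c hcV)
  convert this using 1
  have : (D.ϖ / φ D.ϖ) ^ s = (u ^ s)⁻¹ := by
    rw [hu, ← inv_pow, inv_div]
  rw [this]; ring

lemma In_succ_of_lc [hp : Fact p.Prime] {σ τ : RingAut M} {s : ℕ} (hσ : D.Iso σ) (hτ : D.Iso τ)
    (h : D.In σ s) (h' : D.In τ s) (hl : D.V 1 (D.lc s σ - D.lc s τ)) :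
    D.In (τ⁻¹ * σ) (s + 1) := by
  have hi := hτ.inv.mul hσ
  refine D.In_of_pi hi (s := s + 1) ((In.mul hσ (h'.inv hτ) h).mono (Nat.zero_le _)) ?_ (s+1) le_rfl
  have hpi : D.ϖ ^ (s + 1) ≠ 0 := pow_ne_zero _ D.ne
  have e1 : σ D.ϖ - τ D.ϖ = (D.lc s σ - D.lc s τ) * D.ϖ ^ (s + 1) := by
    unfold lc
    field_simp
    ring
  have e2 : D.V (s + 1 + 1) (σ D.ϖ - τ D.ϖ) := by
    rw [e1]
    exact (hl.mul (D.V_pi.pow (s + 1))).mono (by omega)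
  have e3 : (τ⁻¹ * σ) D.ϖ - D.ϖ = τ⁻¹ (σ D.ϖ - τ D.ϖ) := by
    rw [map_sub, RingAut.mul_apply, ← RingAut.mul_apply τ⁻¹ τ, inv_mul_cancel]; rfl
  rw [e3]
  exact hτ.inv.V.2 e2

/-- counting roots -/
lemma count_roots (ι : Type*) [Fintype ι] (c : ι → M) (α : M) (hα : D.V 0 α)
    (hp : 1 < p) (hc : ∀ i, D.V 0 (c i)) (hr : ∀ i, D.V 1 ((c i) ^ p - α * c i))
    (hinj : ∀ i j, D.V 1 (c i - c j) → i = j) : Fintype.card ι ≤ p := by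
  classical
  let O := D.v.valuationSubring
  let k := IsLocalRing.ResidueField O
  have hres : ∀ x : O, IsLocalRing.residue O x = 0 ↔ D.V 1 (x : M) := by
    intro x
    rw [IsLocalRing.residue_eq_zero_iff, D.V1_iff, ValuationSubring.valuation_lt_one_iff]
    exact (Valuation.isEquiv_iff_val_lt_one.1 (Valuation.isEquiv_valuation_valuationSubring D.v)).symm
  let c' : ι → O := fun i => ⟨c i, D.V0_iff.1 (hc i)⟩
  let α' : O := ⟨α, D.V0_iff.1 hα⟩
  let f : Polynomial k := Polynomial.X ^ p - Polynomial.C (IsLocalRing.residue O α') * Polynomial.X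
  have hdeg : f.natDegree = p := by
    dsimp [f]
    rw [Polynomial.natDegree_sub_eq_left_of_natDegree_lt]
    · simp
    · rw [Polynomial.natDegree_X_pow]
      exact lt_of_le_of_lt (Polynomial.natDegree_C_mul_le _ _ |>.trans Polynomial.natDegree_X_le) hp
  have hf0 : f ≠ 0 := by
    intro h0; rw [h0] at hdeg; simp at hdeg; omega
  have hmem : ∀ i, IsLocalRing.residue O (c' i) ∈ f.roots.toFinset := by
    intro i
    rw [Multiset.mem_toFinset, Polynomial.mem_roots hf0, Polynomial.IsRoot.def]
    have := (hres ((c' i) ^ p - α' * c' i)).2 (hr i)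
    simpa [f] using this
  have hle : Fintype.card ι ≤ f.roots.toFinset.card := by
    rw [← Finset.card_univ]
    refine Finset.card_le_card_of_injOn (fun i => IsLocalRing.residue O (c' i)) (fun i _ => hmem i) ?_
    intro i _ j _ hij
    apply hinj
    have : IsLocalRing.residue O (c' i - c' j) = 0 := by
      rw [map_sub, sub_eq_zero]; exact hij
    exact (hres _).1 this
  calc Fintype.card ι ≤ _ := hle
    _ ≤ Multiset.card f.roots := Multiset.toFinset_card_le _
    _ ≤ f.natDegree := Polynomial.card_roots' f
    _ = p := hdeg

/-- ramification filtration of a group of isometries -/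
def J (D : LD M Γ p) (I : Subgroup (RingAut M)) (hI : ∀ σ ∈ I, D.Iso σ) (s : ℕ) :
    Subgroup (RingAut M) where
  carrier := {σ | σ ∈ I ∧ D.In σ s}
  mul_mem' := fun {a b} ha hb => ⟨I.mul_mem ha.1 hb.1, In.mul (hI b hb.1) ha.2 hb.2⟩
  one_mem' := ⟨I.one_mem, In.one⟩
  inv_mem' := fun {a} ha => ⟨I.inv_mem ha.1, ha.2.inv (hI a ha.1)⟩

lemma J_relIndex [hp : Fact p.Prime] (I : Subgroup (RingAut M)) [Finite I]
    (hI : ∀ σ ∈ I, D.Iso σ) {φ : RingAut M} (hφ : D.Iso φ)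
    (hF : ∀ x, D.V 0 x → D.V 1 (φ x - x ^ p)) (hc : ∀ σ ∈ I, φ * σ = σ * φ) (s : ℕ) :
    (D.J I hI (s + 1)).relIndex (D.J I hI s) ≤ p := by
  classical
  have hJfin : Finite (D.J I hI s) := by
    have : D.J I hI s ≤ I := fun x hx => hx.1
    exact Finite.of_injective (Subgroup.inclusion this) (Subgroup.inclusion_injective this)
  have : Fintype (D.J I hI s ⧸ (D.J I hI (s + 1)).subgroupOf (D.J I hI s)) := Fintype.ofFinite _
  rw [Subgroup.relIndex, Subgroup.index, Nat.card_eq_fintype_card]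
  refine count_roots (D := D) _ (fun x => D.lc s (x.out : RingAut M)) ((D.ϖ / φ D.ϖ) ^ s) ?_
    hp.out.one_lt (fun x => x.out.2.2.lc_V) (fun x => ?_) ?_
  · rw [D.V0_iff, map_pow, map_div₀, hφ, div_self (by exact D.q_ne), one_pow]
  · exact lc_frob hφ hF (hI _ x.out.2.1) x.out.2.2 (hc _ x.out.2.1)
  · intro x y hxy
    have h1 := In_succ_of_lc (hI _ x.out.2.1) (hI _ y.out.2.1) x.out.2.2 y.out.2.2 hxy
    have : (QuotientGroup.mk y.out : D.J I hI s ⧸ (D.J I hI (s + 1)).subgroupOf (D.J I hI s)) =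
        QuotientGroup.mk x.out := by
      rw [QuotientGroup.eq, Subgroup.mem_subgroupOf]
      exact ⟨I.mul_mem (I.inv_mem y.out.2.1) x.out.2.1, h1⟩
    rw [QuotientGroup.out_eq', QuotientGroup.out_eq'] at this
    exact this.symm

lemma J_relIndex_zero [hp : Fact p.Prime] (I : Subgroup (RingAut M)) [Finite I]
    (hI : ∀ σ ∈ I, D.Iso σ) {φ : RingAut M} (hφ : D.Iso φ)
    (hF : ∀ x, D.V 0 x → D.V 1 (φ x - x ^ p)) (hc : ∀ σ ∈ I, φ * σ = σ * φ) :
    (D.J I hI 1).relIndex (D.J I hI 0) + 1 ≤ p := by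
  classical
  have hJfin : Finite (D.J I hI 0) := by
    have : D.J I hI 0 ≤ I := fun x hx => hx.1
    exact Finite.of_injective (Subgroup.inclusion this) (Subgroup.inclusion_injective this)
  let Q := (D.J I hI 0 ⧸ (D.J I hI (0 + 1)).subgroupOf (D.J I hI 0))
  have : Fintype Q := Fintype.ofFinite _
  have hcard : Fintype.card (Option Q) ≤ p := by
    have hm1 : ∀ x : Q, ¬ D.V 1 (D.lc 0 (x.out : RingAut M) - (-1)) := by
      intro x hx
      have : D.lc 0 (x.out : RingAut M) - (-1) = (x.out : RingAut M) D.ϖ / D.ϖ := by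
        unfold lc; field_simp [D.ne]; ring
      rw [this, D.V1_iff, map_div₀, hI _ x.out.2.1, div_self (by exact D.q_ne)] at hx
      exact lt_irrefl _ hx
    have hneg : (-1 : M) ^ p - 1 * (-1) = 0 ∨ D.V 1 ((-1 : M) ^ p - 1 * (-1)) := by
      rcases hp.out.eq_two_or_odd' with h2 | h2
      · right
        subst h2
        have := D.V_p.mono D.he
        norm_num at this ⊢
        exact this
      · left; rw [h2.neg_one_pow]; ring
    refine count_roots (D := D) _ (fun x => match x with
      | none => -1
      | some x => D.lc 0 (x.out : RingAut M)) 1 (by simp [LD.V]) hp.out.one_lt ?_ ?_ ?_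
    · rintro (_ | x)
      · simp [LD.V]
      · exact x.out.2.2.lc_V
    · rintro (_ | x)
      · rcases hneg with h | h
        · dsimp only; rw [h]; exact D.V_zero
        · exact h
      · have := lc_frob hφ hF (hI _ x.out.2.1) x.out.2.2 (hc _ x.out.2.1)
        rwa [pow_zero] at this
    · rintro (_ | x) (_ | y) hxy
      · rfl
      · exfalso
        apply hm1 y
        have := hxy.neg
        rwa [neg_sub] at this
      · exact absurd hxy (hm1 x)
      · congr 1
        have h1 := In_succ_of_lc (hI _ x.out.2.1) (hI _ y.out.2.1) x.out.2.2 y.out.2.2 hxy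
        have : (QuotientGroup.mk y.out : Q) = QuotientGroup.mk x.out := by
          rw [QuotientGroup.eq, Subgroup.mem_subgroupOf]
          exact ⟨I.mul_mem (I.inv_mem y.out.2.1) x.out.2.1, h1⟩
        rw [QuotientGroup.out_eq', QuotientGroup.out_eq'] at this
        exact this.symm
  rw [Fintype.card_option] at hcard
  rw [Subgroup.relIndex, Subgroup.index, Nat.card_eq_fintype_card]
  convert hcard using 2

lemma J_one_pgroup [hp : Fact p.Prime] (I : Subgroup (RingAut M)) [Finite I]
    (hI : ∀ σ ∈ I, D.Iso σ) : IsPGroup p (D.J I hI 1) := by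
  have hJfin : Finite (D.J I hI 1) := by
    have : D.J I hI 1 ≤ I := fun x hx => hx.1
    exact Finite.of_injective (Subgroup.inclusion this) (Subgroup.inclusion_injective this)
  intro σ
  have hn : 0 < orderOf σ := orderOf_pos σ
  obtain ⟨k, l, hl, hkl⟩ := Nat.exists_eq_pow_mul_and_not_dvd hn.ne' p hp.out.ne_one
  refine ⟨k, ?_⟩
  by_contra hne
  set τ := σ ^ p ^ k with hτ
  have hne' : (τ : RingAut M) ≠ 1 := fun h => hne (Subtype.ext h)
  obtain ⟨t, ht⟩ := D.exists_brk (hI _ τ.2.1) (τ.2.2.mono (Nat.zero_le _)) hne'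
  have h1 : 1 ≤ t := ht.le_of_In τ.2.2
  have h2 := (ht.pow h1 hl).ne_one
  apply h2
  have h3 : τ ^ l = 1 := by rw [hτ, ← pow_mul, ← hkl, pow_orderOf_eq_one]
  have := congrArg Subtype.val h3
  simpa using this

end Frob
end LD

end

section
namespace LD

section Desc
variable {M : Type*} [Field M] {Γ : Type*} [LinearOrderedCommGroupWithZero Γ] {p : ℕ}

/-- fixed field of one automorphism -/
def Fx (h : RingAut M) : Subfield M := FixedPoints.subfield (Subgroup.zpowers h) M

lemma mem_Fx {h : RingAut M} {x : M} : x ∈ Fx h ↔ h x = x := by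
  constructor
  · intro hx
    exact hx ⟨h, Subgroup.mem_zpowers h⟩
  · rintro hx ⟨g, n, rfl⟩
    show (h ^ n) x = x
    have : h ∈ MulAction.stabilizer (RingAut M) x := hx
    exact (MulAction.stabilizer (RingAut M) x).zpow_mem this n

/-- restriction of a commuting automorphism -/
def restr (h σ : RingAut M) (hc : σ * h = h * σ) : RingAut (Fx h) where
  toFun x := ⟨σ x, mem_Fx.2 (by
    rw [← RingAut.mul_apply, ← hc, RingAut.mul_apply, mem_Fx.1 x.2])⟩
  invFun x := ⟨σ⁻¹ x, mem_Fx.2 (by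
    have hc' : h * σ⁻¹ = σ⁻¹ * h := by
      rw [eq_inv_mul_iff_mul_eq, ← mul_assoc, hc, mul_inv_cancel_right]
    rw [← RingAut.mul_apply, hc', RingAut.mul_apply, mem_Fx.1 x.2])⟩
  left_inv x := by
    ext; show (σ⁻¹ * σ) (x : M) = x; rw [inv_mul_cancel]; rfl
  right_inv x := by
    ext; show (σ * σ⁻¹) (x : M) = x; rw [mul_inv_cancel]; rfl
  map_mul' x y := by ext; exact map_mul σ _ _
  map_add' x y := by ext; exact map_add σ _ _

lemma restr_apply {h σ : RingAut M} (hc : σ * h = h * σ) (x : Fx h) :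
    ((restr h σ hc x : Fx h) : M) = σ x := rfl

lemma restr_mul {h σ τ : RingAut M} (hc : σ * h = h * σ) (hc' : τ * h = h * τ)
    (hc'' : σ * τ * h = h * (σ * τ)) :
    restr h (σ * τ) hc'' = restr h σ hc * restr h τ hc' := by
  ext x; rfl

lemma restr_pow {h σ : RingAut M} (hc : σ * h = h * σ) (n : ℕ) (hc' : σ ^ n * h = h * σ ^ n) :
    restr h (σ ^ n) hc' = (restr h σ hc) ^ n := by
  induction n with
  | zero => ext x; rfl
  | succ n ih =>
    have h1 : σ ^ n * h = h * σ ^ n := (Commute.pow_left hc n)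
    rw [pow_succ (restr h σ hc), ← ih h1]
    ext x
    simp only [restr_apply, RingAut.mul_apply, pow_succ]

lemma restr_eq_one {h σ : RingAut M} (hfin : IsOfFinOrder h) (hc : σ * h = h * σ)
    (h1 : restr h σ hc = 1) : σ ∈ Subgroup.zpowers h := by
  have hf : Finite (Subgroup.zpowers h) := by
    exact finite_zpowers.2 hfin
  let s : M ≃ₐ[FixedPoints.subfield (Subgroup.zpowers h) M] M :=
    AlgEquiv.ofRingEquiv (f := (σ : M ≃+* M)) (fun r => by
      have := congrArg (fun g : RingAut (Fx h) => ((g r : Fx h) : M)) h1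
      exact this)
  obtain ⟨g, hg⟩ := FixedPoints.toAlgAut_surjective (Subgroup.zpowers h) M s
  have : σ = g := by
    ext x
    have := congrArg (fun f : M ≃ₐ[FixedPoints.subfield (Subgroup.zpowers h) M] M => f x) hg
    exact this.symm
  rw [this]; exact g.2

variable {D : LD M Γ p}

lemma norm_fixed {h : RingAut M} (hhp : h ^ p = 1) (x : M) :
    ∏ j ∈ Finset.range p, (h ^ j) x ∈ Fx h := by
  rw [mem_Fx, map_prod]
  have h1 : ∀ j, h ((h ^ j) x) = (h ^ (j + 1)) x := by
    intro j; rw [pow_succ', RingAut.mul_apply]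
  simp only [h1]
  have e1 := Finset.prod_range_succ (fun j => (h ^ j) x) p
  have e2 := Finset.prod_range_succ' (fun j => (h ^ j) x) p
  by_cases hx : x = 0
  · subst hx; simp
  rw [e1] at e2
  simp only [hhp, pow_zero] at e2
  exact (mul_right_cancel₀ (by simpa using hx) e2).symm

lemma fixed_disc [hp : Fact p.Prime] {h : RingAut M} {t : ℕ} (hB : D.Brk h t) (ht : 1 ≤ t)
    {x : M} (hx : x ≠ 0) (hfx : h x = x) : ∃ m : ℤ, D.v x = (D.q ^ p) ^ m := by
  have key : ∀ y : M, y ≠ 0 → h y = y → D.V 0 y → ∃ m : ℕ, D.v y = (D.q ^ p) ^ m := by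
    intro y hy hfy hV
    obtain ⟨m, hm⟩ := D.exists_pow hy hV
    obtain ⟨k, rfl⟩ := hB.dvd_of_fixed ht hm (by rw [hfy, sub_self]; exact D.V_zero)
    exact ⟨k, by rw [hm, pow_mul]⟩
  rcases le_total (D.v x) 1 with h1 | h1
  · obtain ⟨m, hm⟩ := key x hx hfx (D.V0_iff.2 h1)
    exact ⟨m, by rw [hm, zpow_natCast]⟩
  · obtain ⟨m, hm⟩ := key x⁻¹ (inv_ne_zero hx) (by rw [map_inv₀, hfx]) (by
      rw [D.V0_iff, map_inv₀]; exact inv_le_one_of_one_le₀ h1)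
    refine ⟨-m, ?_⟩
    rw [zpow_neg, zpow_natCast, ← hm, map_inv₀, inv_inv]

lemma v_norm {h : RingAut M} (hi : D.Iso h) :
    D.v (∏ j ∈ Finset.range p, (h ^ j) D.ϖ) = D.q ^ p := by
  rw [map_prod]
  have : ∀ j ∈ Finset.range p, D.v ((h ^ j) D.ϖ) = D.q := fun j _ => hi.pow j _
  rw [Finset.prod_congr rfl this]; simp

lemma p_dvd_e [hp : Fact p.Prime] {h : RingAut M} {t : ℕ} (hB : D.Brk h t) (ht : 1 ≤ t) :
    p ∣ D.e := by
  have : D.v (p : M) = D.q ^ D.e := D.vp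
  exact hB.dvd_of_fixed ht this (by rw [map_natCast, sub_self]; exact D.V_zero)

/-- descent to the fixed field of an element of order `p` -/
def desc [hp : Fact p.Prime] (D : LD M Γ p) (h : RingAut M) (t : ℕ) (hB : D.Brk h t) (ht : 1 ≤ t)
    (hhp : h ^ p = 1) : LD (Fx h) Γ p where
  v := D.v.comap (Fx h).subtype
  ϖ := ⟨∏ j ∈ Finset.range p, (h ^ j) D.ϖ, norm_fixed hhp _⟩
  e := D.e / p
  f := D.f
  ne := by
    intro h0
    have := congrArg Subtype.val h0
    rw [ZeroMemClass.coe_zero] at this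
    have h2 := D.v_norm hB.1
    dsimp only at this
    rw [this, map_zero] at h2
    exact pow_ne_zero _ D.q_ne h2.symm
  lt := by
    show D.v _ < 1
    rw [Subfield.coe_subtype, D.v_norm hB.1]
    exact pow_lt_one₀ zero_le D.q_lt hp.out.ne_zero
  disc := by
    intro x hx
    show ∃ m : ℤ, D.v (x : M) = D.v _ ^ m
    rw [Subfield.coe_subtype, D.v_norm hB.1]
    exact fixed_disc hB ht (fun h0 => hx (Subtype.ext h0)) (mem_Fx.1 x.2)
  vp := by
    show D.v ((p : Fx h) : M) = D.v _ ^ _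
    rw [Subfield.coe_subtype, D.v_norm hB.1, ← pow_mul, Nat.mul_div_cancel' (D.p_dvd_e hB ht)]
    push_cast
    exact D.vp
  he := Nat.div_pos (Nat.le_of_dvd D.he (D.p_dvd_e hB ht)) hp.out.pos
  hf := D.hf
  frob := by
    intro x hx
    show D.v (((x ^ p ^ D.f - x : Fx h)) : M) < 1
    push_cast
    exact D.frob _ hx

variable [hp : Fact p.Prime] {h : RingAut M} {t : ℕ} (hB : D.Brk h t) (ht : 1 ≤ t)
    (hhp : h ^ p = 1)

lemma desc_q : (D.desc h t hB ht hhp).q = D.q ^ p := D.v_norm hB.1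

lemma desc_v (x : Fx h) : (D.desc h t hB ht hhp).v x = D.v (x : M) := rfl

lemma desc_V (m : ℕ) (x : Fx h) : (D.desc h t hB ht hhp).V m x ↔ D.V (p * m) (x : M) := by
  unfold LD.V; rw [desc_q, ← pow_mul]; rfl

lemma desc_brk {σ : RingAut M} (hσ : D.Iso σ) (h0 : D.In σ 0) (hc : σ * h = h * σ)
    (h1 : restr h σ hc ≠ 1) : ∃ s', (D.desc h t hB ht hhp).Brk (restr h σ hc) s' := by
  apply exists_brk
  · intro x; exact hσ _
  · intro x hx
    rw [V1_iff, desc_v]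
    have := h0 (x : M) (by simpa using (desc_V hB ht hhp 0 x).1 hx)
    exact D.V1_iff.1 this
  · exact h1

lemma desc_le {σ : RingAut M} (hc : σ * h = h * σ) {s' r : ℕ}
    (hs' : (D.desc h t hB ht hhp).Brk (restr h σ hc) s')
    (hr : D.V r (∏ j ∈ Finset.range p, (1 + (h ^ j) (D.ra σ)) - 1)) : r ≤ p * s' := by
  have e1 : D.v (σ (∏ j ∈ Finset.range p, (h ^ j) D.ϖ) - ∏ j ∈ Finset.range p, (h ^ j) D.ϖ) =
      D.q ^ (p * (s' + 1)) := by
    rw [pow_mul, ← desc_q hB ht hhp]; exact hs'.2.2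
  have hcj : ∀ j : ℕ, ∀ x, σ ((h ^ j) x) = (h ^ j) (σ x) := by
    intro j x
    have : σ * h ^ j = h ^ j * σ := Commute.pow_right hc j
    rw [← RingAut.mul_apply, this, RingAut.mul_apply]
  have e2 : σ (∏ j ∈ Finset.range p, (h ^ j) D.ϖ) - ∏ j ∈ Finset.range p, (h ^ j) D.ϖ =
      (∏ j ∈ Finset.range p, (h ^ j) D.ϖ) * (∏ j ∈ Finset.range p, (1 + (h ^ j) (D.ra σ)) - 1) := by
    rw [map_prod, mul_sub, mul_one, ← Finset.prod_mul_distrib]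
    congr 1
    refine Finset.prod_congr rfl fun j _ => ?_
    rw [hcj, sigma_pi, map_mul, map_add, map_one]
  have e3 : D.V (p + r) (σ (∏ j ∈ Finset.range p, (h ^ j) D.ϖ) - ∏ j ∈ Finset.range p, (h ^ j) D.ϖ) := by
    rw [e2]
    exact V.mul (D := D) (m := p) (D.v_norm hB.1).le hr
  unfold LD.V at e3
  rw [e1, D.pow_le] at e3
  rw [mul_add, mul_one] at e3
  omega

lemma prod_sub_one_V {s : ℕ} {ι : Type*} (S : Finset ι) (a : ι → M) (ha : ∀ i ∈ S, D.V s (a i)) :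
    D.V s (∏ i ∈ S, (1 + a i) - 1) := by
  classical
  induction S using Finset.induction_on with
  | empty => simpa using D.V_zero
  | insert i S hi ih =>
    rw [Finset.prod_insert hi]
    have e1 := ih (fun j hj => ha j (by simp [hj]))
    have e2 := ha i (by simp)
    have e3 := e2.mul e1
    have := (e1.add e2).add (e3.mono (by omega : s ≤ _))
    convert this using 1
    ring

lemma ra_V {σ : RingAut M} {s : ℕ} (h : D.In σ s) : D.V s (D.ra σ) := by
  refine D.V_div (m := 1) (by simp [q]) ?_
  rw [add_comm]
  exact h _ (D.V_pi.mono (by omega))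

lemma desc_le_gen {σ : RingAut M} (hc : σ * h = h * σ) {s s' : ℕ} (hs : D.In σ s)
    (hs' : (D.desc h t hB ht hhp).Brk (restr h σ hc) s') : s ≤ p * s' := by
  apply desc_le hB ht hhp hc hs'
  refine prod_sub_one_V _ _ fun j _ => ?_
  exact (hB.1.pow j).V.2 (ra_V hs)

/-- no two commuting elements of order `p` with distinct breaks when `e = p ^ 2`, `p` odd -/
lemma rank_odd {h : RingAut M} {t : ℕ} (hB : D.Brk h t) (ht : 1 ≤ t)
    (hhp : h ^ p = 1) (hp3 : 3 ≤ p) (he : D.e = p ^ 2) {σ : RingAut M} (hc : σ * h = h * σ)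
    {s : ℕ} (hs : D.Brk σ s) (hts : t < s) (hσ : IsOfFinOrder σ) : False := by
  have hcg := hB.congr ht hs (by omega) hc.symm
  have hs1 : p + 1 ≤ s := by
    have := Int.le_of_dvd (by omega) hcg
    omega
  have hhfin : IsOfFinOrder h := isOfFinOrder_iff_pow_eq_one.2 ⟨p, hp.out.pos, hhp⟩
  have hne : restr h σ hc ≠ 1 := by
    intro h1
    obtain ⟨n, rfl⟩ := hhfin.mem_powers_iff_mem_zpowers.2 (restr_eq_one hhfin hc h1)
    change D.Brk (h ^ n) s at hs
    by_cases hd : p ∣ n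
    · obtain ⟨k, rfl⟩ := hd
      apply hs.ne_one
      rw [pow_mul, hhp, one_pow]
    · have := hs.unique (hB.pow ht hd)
      omega
  obtain ⟨s', hs'⟩ := desc_brk hB ht hhp hs.1 hs.2.1 hc hne
  have h1 := desc_le_gen hB ht hhp hc hs.In hs'
  have h2 : 2 ≤ s' := by
    by_contra hlt
    have : p * s' ≤ p * 1 := Nat.mul_le_mul_left p (by omega)
    omega
  obtain ⟨n, hn, hn1⟩ := isOfFinOrder_iff_pow_eq_one.1 hσ
  have hfin' : IsOfFinOrder (restr h σ hc) := by
    refine isOfFinOrder_iff_pow_eq_one.2 ⟨n, hn, ?_⟩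
    rw [← restr_pow hc n (Commute.pow_left hc n)]
    ext x
    show (σ ^ n) (x : M) = x
    rw [hn1]; rfl
  have h3 := hs'.le_e (by omega) hfin'
  have h4 : (D.desc h t hB ht hhp).e = p := by
    show D.e / p = p
    rw [he, sq]; exact Nat.mul_div_cancel_left p hp.out.pos
  rw [h4] at h3
  have : (p - 1) * 2 ≤ (p - 1) * s' := Nat.mul_le_mul_left _ h2
  omega

end Desc

section Two
variable {M : Type*} [Field M] {Γ : Type*} [LinearOrderedCommGroupWithZero Γ]
  {D : LD M Γ 2} {h : RingAut M} {t : ℕ} (hB : D.Brk h t) (ht : 1 ≤ t) (hhp : h ^ 2 = 1)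

lemma desc_le_two {σ : RingAut M} (hc : σ * h = h * σ) {s s' r : ℕ} (hs : D.In σ s)
    (hs' : (D.desc h t hB ht hhp).Brk (restr h σ hc) s') (h1 : r ≤ D.e + s) (h2 : r ≤ s + t)
    (h3 : r ≤ 2 * s) : r ≤ 2 * s' := by
  apply desc_le hB ht hhp hc hs'
  have ha := ra_V hs
  set a := D.ra σ
  have e1 : D.V (D.e + s) ((2 : ℕ) * a) := D.V_p.mul ha
  have e2 := hB.step ht ha
  have e3 := ha.mul (hB.1.V.2 ha)
  have := ((e1.mono h1).add (e2.mono h2)).add (e3.mono (by omega : r ≤ _))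
  convert this using 1
  rw [Finset.prod_range_succ, Finset.prod_range_one, pow_zero, pow_one, RingAut.one_apply]
  push_cast
  ring

/-- no three commuting involutions with distinct breaks when `e = 8` -/
lemma rank_two {h : RingAut M} {t : ℕ} (hB : D.Brk h t) (ht : 1 ≤ t)
    (hhp : h ^ 2 = 1) (he : D.e = 8) {g σ : RingAut M} (hcg : g * h = h * g) (hcσ : σ * h = h * σ)
    (hgσ : σ * g = g * σ) (hg2 : g ^ 2 = 1) (hσ2 : σ ^ 2 = 1) {s r : ℕ} (hg : D.Brk g s)
    (hσ : D.Brk σ r) (hts : t < s) (hsr : s < r) : False := by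
  have c1 := hB.congr ht hg (by omega) hcg.symm
  have c2 := hg.congr (by omega) hσ (by omega) hgσ.symm
  have hs3 : 3 ≤ s := by omega
  have hr5 : 5 ≤ r := by omega
  have hhfin : IsOfFinOrder h := isOfFinOrder_iff_pow_eq_one.2 ⟨2, by omega, hhp⟩
  have zp : ∀ {M : Type _} [Field M] {h x : RingAut M}, h ^ 2 = 1 → x ∈ Subgroup.zpowers h → x = 1 ∨ x = h := by
    intro M _ h x hh hx
    obtain ⟨n, rfl⟩ := hx
    rcases Int.even_or_odd' n with ⟨k, rfl | rfl⟩
    · left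
      show h ^ (2 * k) = 1
      rw [zpow_mul, zpow_ofNat, hh, one_zpow]
    · right
      show h ^ (2 * k + 1) = h
      rw [zpow_add, zpow_mul, zpow_ofNat, hh, one_zpow, one_mul, zpow_one]
  -- elements deep in the filtration restrict nontrivially
  have nt : ∀ x (hx : x * h = h * x), D.In x s → restr h x hx = 1 → x = 1 := by
    intro x hx hi h1
    rcases zp hhp (restr_eq_one hhfin hx h1) with h2 | h2
    · exact h2
    · rw [h2] at hi
      have := hB.le_of_In hi
      omega
  have ng : restr h g hcg ≠ 1 := fun h1 => hg.ne_one (nt g hcg hg.In h1)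
  have nσ : restr h σ hcσ ≠ 1 := fun h1 => hσ.ne_one (nt σ hcσ (hσ.In.mono hsr.le) h1)
  obtain ⟨s', hs'⟩ := desc_brk hB ht hhp hg.1 hg.2.1 hcg ng
  obtain ⟨r', hr'⟩ := desc_brk hB ht hhp hσ.1 hσ.2.1 hcσ nσ
  have b2 : 2 ≤ s' := by
    have := desc_le_two (r := 4) hB ht hhp hcg hg.In hs' (by omega) (by omega) (by omega)
    omega
  have b3 : 3 ≤ r' := by
    have := desc_le_two (r := 6) hB ht hhp hcσ hσ.In hr' (by omega) (by omega) (by omega)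
    omega
  set D' := D.desc h t hB ht hhp with hD'
  set g' := restr h g hcg with hg'
  set σ' := restr h σ hcσ with hσ'
  have he' : D'.e = 4 := by show D.e / 2 = 4; rw [he]
  have hg'2 : g' ^ 2 = 1 := by
    rw [hg', ← restr_pow hcg 2 (Commute.pow_left hcg 2)]
    ext x
    show (g ^ 2) (x : M) = x
    rw [hg2]; rfl
  have hσ'2 : σ' ^ 2 = 1 := by
    rw [hσ', ← restr_pow hcσ 2 (Commute.pow_left hcσ 2)]
    ext x
    show (σ ^ 2) (x : M) = x
    rw [hσ2]; rfl
  have hc' : σ' * g' = g' * σ' := by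
    ext x
    show σ (g (x : M)) = g (σ (x : M))
    rw [← RingAut.mul_apply, hgσ]; rfl
  have ng' : restr g' σ' hc' ≠ 1 := by
    intro h1
    have hfin' : IsOfFinOrder g' := isOfFinOrder_iff_pow_eq_one.2 ⟨2, by omega, hg'2⟩
    rcases zp hg'2 (restr_eq_one hfin' hc' h1) with h2 | h2
    · exact nσ h2
    · have h3 : σ * g = 1 := by
        have hcc : σ * g * h = h * (σ * g) := by
          rw [mul_assoc, hcg, ← mul_assoc, hcσ, mul_assoc]
        apply nt (σ * g) hcc (In.mul hg.1 (hσ.In.mono hsr.le) hg.In)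
        rw [restr_mul hcσ hcg, ← hg', ← hσ', h2, ← sq, hg'2]
      have h4 : σ = g := by
        have : σ * g * g = g := by rw [h3, one_mul]
        rwa [mul_assoc, ← sq, hg2, mul_one] at this
      rw [h4] at hσ
      have := hσ.unique hg
      omega
  have hs'1 : 1 ≤ s' := by omega
  obtain ⟨r'', hr''⟩ := desc_brk hs' hs'1 hg'2 hr'.1 hr'.2.1 hc' ng'
  have b4 := desc_le_two (r := 5) hs' hs'1 hg'2 hc' hr'.In hr'' (by omega) (by omega) (by omega)
  have hfin'' : IsOfFinOrder (restr g' σ' hc') := by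
    refine isOfFinOrder_iff_pow_eq_one.2 ⟨2, by omega, ?_⟩
    rw [← restr_pow hc' 2 (Commute.pow_left hc' 2)]
    ext x
    show (((σ' ^ 2) (x : Fx h) : Fx h) : M) = x
    rw [hσ'2]; rfl
  have h3 := hr''.le_e (by omega) hfin''
  have he'' : (D'.desc g' s' hs' hs'1 hg'2).e = 2 := by show D'.e / 2 = 2; rw [he']
  rw [he''] at h3
  omega

end Two
end LD

end

section
namespace LD

/-- A finite abelian group of inertial isometries commuting with a Frobenius. -/
structure Good {M : Type*} [Field M] {Γ : Type*} [LinearOrderedCommGroupWithZero Γ] {p : ℕ}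
    (D : LD M Γ p) (I : Subgroup (RingAut M)) (φ : RingAut M) : Prop where
  fin : Finite I
  iso : ∀ σ ∈ I, D.Iso σ
  in0 : ∀ σ ∈ I, D.In σ 0
  isoφ : D.Iso φ
  frb : ∀ x, D.V 0 x → D.V 1 (φ x - x ^ p)
  commφ : ∀ σ ∈ I, φ * σ = σ * φ
  comm : ∀ σ ∈ I, ∀ τ ∈ I, σ * τ = τ * σ

section
variable {M : Type*} [Field M] {Γ : Type*} [LinearOrderedCommGroupWithZero Γ] {p : ℕ}
  {D : LD M Γ p} {I : Subgroup (RingAut M)} {φ : RingAut M}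

lemma Good.J_zero (g : D.Good I φ) : D.J I g.iso 0 = I := by
  ext σ; exact ⟨fun h => h.1, fun h => ⟨h, g.in0 σ h⟩⟩

lemma J_le (hI : ∀ σ ∈ I, D.Iso σ) (s : ℕ) : D.J I hI s ≤ I := fun _ h => h.1

lemma J_anti (hI : ∀ σ ∈ I, D.Iso σ) {s s' : ℕ} (h : s ≤ s') : D.J I hI s' ≤ D.J I hI s :=
  fun _ hx => ⟨hx.1, hx.2.mono h⟩

lemma card_mul_relIndex' {G : Type*} [Group G] {H K : Subgroup G} (h : H ≤ K) :
    Nat.card H * H.relIndex K = Nat.card K := by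
  have := Subgroup.card_mul_index (H.subgroupOf K)
  rwa [Nat.card_congr (Subgroup.subgroupOfEquivOfLe h).toEquiv] at this

lemma Good.isOfFinOrder (g : D.Good I φ) {σ : RingAut M} (h : σ ∈ I) : IsOfFinOrder σ := by
  have := g.fin
  have h1 : IsOfFinOrder (⟨σ, h⟩ : I) := isOfFinOrder_of_finite _
  exact (Submonoid.isOfFinOrder_coe (x := (⟨σ, h⟩ : I.toSubmonoid))).2 h1

lemma Good.tame [hp : Fact p.Prime] (g : D.Good I φ) :
    ∃ e0 k, Nat.card I = e0 * p ^ k ∧ e0 + 1 ≤ p ∧ Nat.card (D.J I g.iso 1) = p ^ k := by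
  have := g.fin
  have hJfin : Finite (D.J I g.iso 1) :=
    Finite.of_injective (Subgroup.inclusion (J_le g.iso 1)) (Subgroup.inclusion_injective _)
  obtain ⟨k, hk⟩ := (J_one_pgroup (D := D) I g.iso).exists_card_eq
  refine ⟨(D.J I g.iso 1).relIndex (D.J I g.iso 0), k, ?_, 
    J_relIndex_zero I g.iso g.isoφ g.frb g.commφ, hk⟩
  have := card_mul_relIndex' (J_anti g.iso (Nat.zero_le 1))
  rw [hk, g.J_zero, mul_comm] at this
  rw [g.J_zero]
  exact this.symm

lemma Good.wild [hp : Fact p.Prime] (g : D.Good I φ) {k : ℕ} (hk : Nat.card I = p ^ k) :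
    D.J I g.iso 1 = I := by
  have := g.fin
  have hJfin : Finite (D.J I g.iso 1) :=
    Finite.of_injective (Subgroup.inclusion (J_le g.iso 1)) (Subgroup.inclusion_injective _)
  obtain ⟨e0, k', h1, h2, h3⟩ := g.tame
  have hd : e0 ∣ p ^ k := by rw [← hk, h1]; exact dvd_mul_right _ _
  obtain ⟨j, _, hj⟩ := (Nat.dvd_prime_pow hp.out).1 hd
  have hj0 : j = 0 := by
    by_contra h0
    have : p ≤ p ^ j := Nat.le_self_pow h0 p
    omega
  rw [hj, hj0, pow_zero, one_mul] at h1
  apply Subgroup.eq_of_le_of_card_ge (J_le g.iso 1)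
  rw [h1, h3]

lemma Good.first_break [hp : Fact p.Prime] (g : D.Good I φ) {u : ℕ}
    (hu : 1 < Nat.card (D.J I g.iso u)) :
    ∃ s, u ≤ s ∧ (∃ h ∈ I, D.Brk h s) ∧
      Nat.card (D.J I g.iso u) ≤ p * Nat.card (D.J I g.iso (s + 1)) := by
  classical
  have := g.fin
  have hJfin : ∀ u, Finite (D.J I g.iso u) := fun u =>
    Finite.of_injective (Subgroup.inclusion (J_le g.iso u)) (Subgroup.inclusion_injective _)
  have hex : ∃ s, ∃ h ∈ D.J I g.iso u, D.Brk h s := by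
    have := Finite.one_lt_card_iff_nontrivial.1 hu
    obtain ⟨x, hx⟩ := exists_ne (1 : D.J I g.iso u)
    obtain ⟨t, ht⟩ := D.exists_brk (g.iso _ x.2.1) (g.in0 _ x.2.1) (fun h => hx (Subtype.ext h))
    exact ⟨t, x, x.2, ht⟩
  set s := Nat.find hex with hs
  obtain ⟨h, hh, hB⟩ := Nat.find_spec hex
  refine ⟨s, hB.le_of_In hh.2, ⟨h, hh.1, hB⟩, ?_⟩
  have hle : D.J I g.iso u ≤ D.J I g.iso s := by
    intro x hx
    refine ⟨hx.1, ?_⟩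
    by_cases h1 : x = 1
    · subst h1; exact In.one
    obtain ⟨t, ht⟩ := D.exists_brk (g.iso _ hx.1) (g.in0 _ hx.1) h1
    exact ht.In.mono (Nat.find_min' hex ⟨x, hx, ht⟩)
  have h1 : Nat.card (D.J I g.iso u) ≤ Nat.card (D.J I g.iso s) := Subgroup.card_le_of_le hle
  have h2 := card_mul_relIndex' (J_anti (I := I) g.iso (Nat.le_succ s))
  have h3 := J_relIndex I g.iso g.isoφ g.frb g.commφ s
  calc _ ≤ _ := h1
    _ = _ := h2.symm
    _ ≤ _ := by rw [mul_comm]; exact Nat.mul_le_mul_right _ h3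

lemma Good.rank_odd [hp : Fact p.Prime] (g : D.Good I φ) (hp3 : 3 ≤ p) (he : D.e = p ^ 2)
    (hI : Nat.card I = p ^ 2) (hx : ∀ x ∈ I, x ^ p = 1) : False := by
  have hw := g.wild hI
  have hp1 := hp.out.one_lt
  obtain ⟨t, ht, ⟨h, hh, hB⟩, hc⟩ := g.first_break (u := 1) (by rw [hw, hI]; nlinarith)
  rw [hw, hI] at hc
  have hc' : p ≤ Nat.card (D.J I g.iso (t + 1)) := by
    by_contra hlt
    push Not at hlt
    have : p * Nat.card (D.J I g.iso (t + 1)) < p * p := by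
      exact Nat.mul_lt_mul_of_pos_left hlt (by omega)
    nlinarith
  obtain ⟨s, hs, ⟨σ, hσ, hBσ⟩, _⟩ := g.first_break (u := t + 1) (by omega)
  exact LD.rank_odd hB ht (hx h hh) hp3 he (g.comm σ hσ h hh) hBσ (by omega) (g.isOfFinOrder hσ)

end

section
variable {M : Type*} [Field M] {Γ : Type*} [LinearOrderedCommGroupWithZero Γ]
  {D : LD M Γ 2} {I : Subgroup (RingAut M)} {φ : RingAut M}

lemma Good.rank_two (g : D.Good I φ) (he : D.e = 8)
    (hI : Nat.card I = 8) (hx : ∀ x ∈ I, x ^ 2 = 1) : False := by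
  have hw := g.wild (k := 3) (by rw [hI]; norm_num)
  obtain ⟨t, ht, ⟨h, hh, hB⟩, hc⟩ := g.first_break (u := 1) (by rw [hw, hI]; norm_num)
  rw [hw, hI] at hc
  obtain ⟨s, hs, ⟨σ, hσ, hBσ⟩, hc2⟩ := g.first_break (u := t + 1) (by omega)
  obtain ⟨r, hr, ⟨τ, hτ, hBτ⟩, _⟩ := g.first_break (u := s + 1) (by omega)
  exact LD.rank_two hB ht (hx h hh) he (g.comm σ hσ h hh) (g.comm τ hτ h hh)
    (g.comm τ hτ σ hσ) (hx σ hσ) (hx τ hτ) hBσ hBτ (by omega) (by omega)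

end

section Cyc

lemma sum_range_mul (p n : ℕ) (F : ℕ → ℕ) :
    ∑ i ∈ Finset.range (p * n), F i = ∑ i ∈ Finset.range n, ∑ r ∈ Finset.range p, F (p * i + r) := by
  induction n with
  | zero => simp
  | succ n ih => rw [Finset.sum_range_succ, ← ih, mul_add, mul_one, Finset.sum_range_add]

/-- odd case sum -/
lemma sum_val_odd (p : ℕ) (hp : 1 ≤ p) (k : ℕ) : ∀ (F : ℕ → ℕ),
    (∀ j i, i < p ^ k → i ≠ 0 → p ^ j ∣ i → p ^ j ≤ F i) →
    k * (p - 1) * p ^ k ≤ p * ∑ i ∈ Finset.range (p ^ k), F i := by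
  induction k with
  | zero => intro F _; simp
  | succ k ih =>
    intro F hF
    rw [pow_succ', sum_range_mul]
    have hlt : ∀ i r, i < p ^ k → r < p → p * i + r < p ^ (k + 1) := by
      intro i r hi hr
      rw [pow_succ']
      calc p * i + r < p * i + p := by omega
        _ = p * (i + 1) := by ring
        _ ≤ p * p ^ k := Nat.mul_le_mul_left p hi
    obtain ⟨m, rfl⟩ : ∃ m, p = m + 1 := ⟨p - 1, by omega⟩
    set p := m + 1 with hpm
    have hG := ih (fun i => F (p * i) / p) (by
      intro j i hi h0 hd
      rw [Nat.le_div_iff_mul_le (by omega), ← pow_succ]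
      refine hF (j + 1) (p * i) (by simpa using hlt i 0 hi (by omega)) (by positivity) ?_
      rw [pow_succ']; exact Nat.mul_dvd_mul_left p hd)
    have hterm : ∀ i ∈ Finset.range (p ^ k), p * (F (p * i) / p) + m ≤
        ∑ r ∈ Finset.range p, F (p * i + r) := by
      intro i hi
      rw [Finset.mem_range] at hi
      rw [hpm, Finset.sum_range_succ', ← hpm, add_comm]
      refine Nat.add_le_add ?_ (by simpa using Nat.mul_div_le (F (p * i)) p)
      calc m = ∑ r ∈ Finset.range m, 1 := by simp
        _ ≤ _ := Finset.sum_le_sum fun r hr => by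
          rw [Finset.mem_range] at hr
          simpa using hF 0 (p * i + (r + 1)) (hlt i _ hi (by omega)) (by omega) (by simp)
    have hsum := Finset.sum_le_sum hterm
    rw [Finset.sum_add_distrib, ← Finset.mul_sum] at hsum
    simp only [Finset.sum_const, Finset.card_range, smul_eq_mul] at hsum
    have e1 := Nat.mul_le_mul_left p hsum
    refine le_trans ?_ e1
    have e2 := Nat.mul_le_mul_left p hG
    have : p - 1 = m := by omega
    rw [this] at e2 ⊢
    nlinarith

end Cyc

section
variable {M : Type*} [Field M] {Γ : Type*} [LinearOrderedCommGroupWithZero Γ] {p : ℕ}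
  {D : LD M Γ p} {I : Subgroup (RingAut M)} {φ : RingAut M}

/-- the break, as a function -/
noncomputable def bk (D : LD M Γ p) (σ : RingAut M) : ℕ := by
  classical
  exact if h : ∃ t, D.Brk σ t then h.choose else 0

lemma Brk.bk {σ : RingAut M} {t : ℕ} (h : D.Brk σ t) : D.bk σ = t := by
  have hex : ∃ t, D.Brk σ t := ⟨t, h⟩
  unfold LD.bk
  rw [dif_pos hex]
  exact h.unique hex.choose_spec

lemma Good.brk [hp : Fact p.Prime] (g : D.Good I φ) {σ : RingAut M} (h : σ ∈ I) (h1 : σ ≠ 1) :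
    D.Brk σ (D.bk σ) := by
  obtain ⟨t, ht⟩ := D.exists_brk (g.iso _ h) (g.in0 _ h) h1
  rw [ht.bk]; exact ht

lemma Good.brk_pos [hp : Fact p.Prime] (g : D.Good I φ) {k : ℕ} (hk : Nat.card I = p ^ k)
    {σ : RingAut M} (h : σ ∈ I) (h1 : σ ≠ 1) : 1 ≤ D.bk σ := by
  have := g.wild hk
  rw [← this] at h
  exact (g.brk h.1 h1).le_of_In h.2

lemma Good.growth [hp : Fact p.Prime] (g : D.Good I φ) {k : ℕ} (hk : Nat.card I = p ^ k)
    {σ : RingAut M} (h : σ ∈ I) (j : ℕ) (h1 : σ ^ p ^ j ≠ 1) : p ^ j ≤ D.bk (σ ^ p ^ j) := by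
  induction j with
  | zero => simpa using g.brk_pos hk h (by simpa using h1)
  | succ j ih =>
    have h2 : σ ^ p ^ j ≠ 1 := by
      intro h0; apply h1; rw [pow_succ, pow_mul, h0, one_pow]
    have e1 := g.brk (I.pow_mem h _) h2
    have e2 := g.brk (I.pow_mem h _) h1
    have i2 := ih h2
    rw [pow_succ p j, pow_mul] at e2 ⊢
    have := e1.powp (le_trans (Nat.one_le_pow _ _ hp.out.pos) i2)
      (g.isOfFinOrder (I.pow_mem h _)) e2
    exact le_trans (by rw [mul_comm]; exact Nat.mul_le_mul_left p i2) this


lemma prod_V [hp : Fact p.Prime] (g : D.Good I φ) {σ : RingAut M} (h : σ ∈ I) (S : Finset ℕ)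
    (hS : ∀ i ∈ S, σ ^ i ≠ 1) :
    D.V (∑ i ∈ S, (D.bk (σ ^ i) + 1)) (∏ i ∈ S, ((σ ^ i) D.ϖ - D.ϖ)) := by
  unfold LD.V
  rw [map_prod, ← Finset.prod_pow_eq_pow_sum]
  refine le_of_eq (Finset.prod_congr rfl fun i hi => ?_)
  exact (g.brk (I.pow_mem h i) (hS i hi)).2.2

lemma Good.cyc_odd [hp : Fact p.Prime] (g : D.Good I φ) (hp3 : 3 ≤ p) {k : ℕ} (hk1 : 1 ≤ k)
    (hk : Nat.card I = p ^ k) {σ : RingAut M} (h : σ ∈ I) (ho : orderOf σ = p ^ k) :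
    ∃ d, 2 * (k + 1) * p ^ k ≤ 3 * d ∧
      D.V d (∏ i ∈ (Finset.range (p ^ k)).erase 0, ((σ ^ i) D.ϖ - D.ϖ)) := by
  have hne : ∀ i, i < p ^ k → i ≠ 0 → σ ^ i ≠ 1 := by
    intro i hi h0 h1
    exact absurd (orderOf_le_of_pow_eq_one (Nat.pos_of_ne_zero h0) h1) (by omega)
  refine ⟨_, ?_, prod_V g h _ (fun i hi => ?_)⟩
  · have h0 : (0 : ℕ) ∈ Finset.range (p ^ k) := by
      rw [Finset.mem_range]; exact pow_pos hp.out.pos k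
    have e1 := sum_val_odd p hp.out.one_le k (fun i => if i = 0 then 0 else D.bk (σ ^ i)) (by
      intro j i hi hi0 hd
      rw [if_neg hi0]
      obtain ⟨m, rfl⟩ := hd
      have := hne _ hi hi0
      rw [mul_comm, pow_mul] at this ⊢
      exact g.growth hk (I.pow_mem h m) j this)
    rw [← Finset.add_sum_erase _ _ h0, if_pos rfl, zero_add] at e1
    have e2 : ∑ i ∈ (Finset.range (p ^ k)).erase 0, (if i = 0 then 0 else D.bk (σ ^ i)) =
        ∑ i ∈ (Finset.range (p ^ k)).erase 0, D.bk (σ ^ i) :=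
      Finset.sum_congr rfl fun i hi => if_neg (Finset.ne_of_mem_erase hi)
    rw [e2] at e1
    rw [Finset.sum_add_distrib]
    simp only [Finset.sum_const, Finset.card_erase_of_mem h0, Finset.card_range, smul_eq_mul,
      mul_one]
    set S := ∑ i ∈ (Finset.range (p ^ k)).erase 0, D.bk (σ ^ i)
    have hq : 3 ≤ p ^ k := le_trans hp3 (Nat.le_self_pow (by omega) p)
    set Q := p ^ k
    obtain ⟨Q', hQ'⟩ : ∃ Q', Q = Q' + 1 := ⟨Q - 1, by omega⟩
    obtain ⟨r, hr⟩ : ∃ r, p = r + 1 := ⟨p - 1, by omega⟩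
    have hr2 : p - 1 = r := by omega
    have hq2 : Q - 1 = Q' := by omega
    rw [hr2] at e1
    rw [hq2]
    refine le_of_mul_le_mul_left (a := p) ?_ (by omega)
    have e3 : 2 * p ≤ 3 * r := by omega
    have e4 : 2 * Q ≤ 3 * Q' := by omega
    have e5 := Nat.mul_le_mul_left (k * Q) e3
    have e6 := Nat.mul_le_mul_left p e4
    nlinarith
  · rw [Finset.mem_erase, Finset.mem_range] at hi
    exact hne i hi.2 hi.1

end

section
variable {M : Type*} [Field M] {Γ : Type*} [LinearOrderedCommGroupWithZero Γ]
  {D : LD M Γ 2} {I : Subgroup (RingAut M)} {φ : RingAut M}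

lemma Good.growth_two (g : D.Good I φ) {k : ℕ} (hk : Nat.card I = 2 ^ k)
    {σ : RingAut M} (h : σ ∈ I) (j : ℕ) (h1 : σ ^ 2 ^ j ≠ 1) :
    2 * 2 ^ j ≤ D.bk (σ ^ 2 ^ j) + 1 := by
  induction j with
  | zero => simpa using g.brk_pos hk h (by simpa using h1)
  | succ j ih =>
    have h2 : σ ^ 2 ^ j ≠ 1 := by
      intro h0; apply h1; rw [pow_succ, pow_mul, h0, one_pow]
    have e1 := g.brk (I.pow_mem h _) h2
    have e2 := g.brk (I.pow_mem h _) h1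
    have i2 := ih h2
    have pos := Nat.one_le_two_pow (n := j)
    rw [pow_succ 2 j, pow_mul] at e2 ⊢
    have := e1.powp (by omega) (g.isOfFinOrder (I.pow_mem h _)) e2
    have hc := e1.congr (by omega) e2 (by omega) (by group)
    omega

lemma Good.cyc_two (g : D.Good I φ) {k : ℕ}
    (hk : Nat.card I = 2 ^ k) {σ : RingAut M} (h : σ ∈ I) (ho : orderOf σ = 2 ^ k) :
    ∃ d, k * 2 ^ k ≤ d ∧
      D.V d (∏ i ∈ (Finset.range (2 ^ k)).erase 0, ((σ ^ i) D.ϖ - D.ϖ)) := by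
  have hne : ∀ i, i < 2 ^ k → i ≠ 0 → σ ^ i ≠ 1 := by
    intro i hi h0 h1
    exact absurd (orderOf_le_of_pow_eq_one (Nat.pos_of_ne_zero h0) h1) (by omega)
  refine ⟨_, ?_, prod_V g h _ (fun i hi => ?_)⟩
  · have h0 : (0 : ℕ) ∈ Finset.range (2 ^ k) := by
      rw [Finset.mem_range]; exact pow_pos (by norm_num) k
    have e1 := sum_val_odd 2 (by norm_num) k
      (fun i => if i = 0 then 0 else (D.bk (σ ^ i) + 1) / 2) (by
      intro j i hi hi0 hd
      rw [if_neg hi0]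
      obtain ⟨m, rfl⟩ := hd
      have := hne _ hi hi0
      rw [mul_comm, pow_mul] at this ⊢
      have := g.growth_two hk (I.pow_mem h m) j this
      omega)
    rw [← Finset.add_sum_erase _ _ h0, if_pos rfl, zero_add, Finset.mul_sum] at e1
    have e2 : ∑ i ∈ (Finset.range (2 ^ k)).erase 0,
        2 * (if i = 0 then 0 else (D.bk (σ ^ i) + 1) / 2) ≤
        ∑ i ∈ (Finset.range (2 ^ k)).erase 0, (D.bk (σ ^ i) + 1) :=
      Finset.sum_le_sum fun i hi => by
        rw [if_neg (Finset.ne_of_mem_erase hi)]; omega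
    simpa using e1.trans e2
  · rw [Finset.mem_erase, Finset.mem_range] at hi
    exact hne i hi.2 hi.1

end
end LD

end

section
open NumberField IsDedekindDomain

namespace AB

section ldsec
variable {K : Type*} [Field K] [NumberField K]

instance (w : HeightOneSpectrum (𝓞 K)) : w.asIdeal.IsPrime := w.isPrime
instance (w : HeightOneSpectrum (𝓞 K)) : w.asIdeal.IsMaximal := w.isMaximal

instance finite_quot (w : HeightOneSpectrum (𝓞 K)) : Finite (𝓞 K ⧸ w.asIdeal) :=
  Ideal.finiteQuotientOfFreeOfNeBot _ w.ne_bot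

lemma valp (w : HeightOneSpectrum (𝓞 K)) (p : ℕ) [hp : Fact p.Prime]
    [hw : w.asIdeal.LiesOver (Ideal.span {(p : ℤ)})] :
    w.intValuation (p : 𝓞 K) = WithZero.exp (-(w.asIdeal.ramificationIdx ℤ : ℤ)) := by
  have h0 : (p : 𝓞 K) ≠ 0 := by exact_mod_cast hp.out.ne_zero
  have hm : Ideal.map (algebraMap ℤ (𝓞 K)) (Ideal.span {(p : ℤ)}) = Ideal.span {(p : 𝓞 K)} := by
    rw [Ideal.map_span]; simp
  rw [w.intValuation_eq_exp_neg_multiplicity h0,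
    Ideal.IsDedekindDomain.ramificationIdx_eq_multiplicity (Ideal.span {(p : ℤ)}) w.asIdeal, hm]
  rw [hm]; simpa using h0

lemma exists_approx (w : HeightOneSpectrum (𝓞 K)) {x : K} (hx : w.valuation K x ≤ 1) :
    ∃ a : 𝓞 K, w.valuation K (algebraMap (𝓞 K) K a - x) < 1 := by
  simpa using w.exists_valuation_sub_lt_of_integer hx 1

lemma pow_sub_lt (w : HeightOneSpectrum (𝓞 K)) {x : K} (hx : w.valuation K x ≤ 1)
    {a : 𝓞 K} (ha : w.valuation K (algebraMap (𝓞 K) K a - x) < 1) (q : ℕ) :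
    w.valuation K (algebraMap (𝓞 K) K a ^ q - x ^ q) < 1 := by
      have hk := (Commute.all (algebraMap (𝓞 K) K a) x).mul_geom_sum₂ q
      rw [← hk, map_mul]
      refine mul_lt_one_of_lt_of_le ha ?_
      refine Valuation.map_sum_le _ fun i _ => ?_
      rw [map_mul, map_pow, map_pow]
      exact mul_le_one' (pow_le_one₀ zero_le (w.valuation_le_one a)) (pow_le_one₀ zero_le hx)

lemma absN (w : HeightOneSpectrum (𝓞 K)) (p : ℕ) 
    [hw : w.asIdeal.LiesOver (Ideal.span {(p : ℤ)})] :
    Ideal.absNorm w.asIdeal = p ^ (w.asIdeal.inertiaDeg ℤ) := by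
  rw [← Ideal.absNorm_pow_inertiaDeg (Ideal.span {(p : ℤ)}) w.asIdeal]; simp

lemma exists_LD (w : HeightOneSpectrum (𝓞 K)) (p : ℕ) [hp : Fact p.Prime]
    [hw : w.asIdeal.LiesOver (Ideal.span {(p : ℤ)})] :
    ∃ D : LD K (WithZero (Multiplicative ℤ)) p, D.v = w.valuation K ∧
      D.e = w.asIdeal.ramificationIdx ℤ ∧ D.v D.ϖ = WithZero.exp (-1) ∧
      ∃ π : 𝓞 K, algebraMap (𝓞 K) K π = D.ϖ := by
  obtain ⟨π, hπ⟩ := w.intValuation_exists_uniformizer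
  have hv : w.valuation K (algebraMap (𝓞 K) K π) = WithZero.exp (-1) := by
    rw [w.valuation_of_algebraMap, hπ]
  have hcard : Nat.card (𝓞 K ⧸ w.asIdeal) = p ^ (w.asIdeal.inertiaDeg ℤ) := by
    rw [← absN w p, Ideal.absNorm_apply]; rfl
  have hfr : ∀ a : 𝓞 K, a ^ (p ^ (w.asIdeal.inertiaDeg ℤ)) - a ∈ w.asIdeal := by
    intro a
    rw [← Ideal.Quotient.eq, map_pow, ← hcard]
    let := Ideal.Quotient.field w.asIdeal
    let := Fintype.ofFinite (𝓞 K ⧸ w.asIdeal)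
    rw [Nat.card_eq_fintype_card]
    exact FiniteField.pow_card _
  refine ⟨⟨w.valuation K, algebraMap (𝓞 K) K π, w.asIdeal.ramificationIdx ℤ,
    w.asIdeal.inertiaDeg ℤ, ?_, ?_, ?_, ?_, ?_, ?_, ?_⟩, rfl, rfl, hv, π, rfl⟩
  · intro h; rw [h, map_zero] at hv; exact WithZero.exp_ne_zero hv.symm
  · rw [hv, ← WithZero.exp_zero, WithZero.exp_lt_exp]; norm_num
  · intro x hx
    have hx' : w.valuation K x ≠ 0 := (Valuation.ne_zero_iff _).2 hx
    refine ⟨-WithZero.log (w.valuation K x), ?_⟩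
    rw [hv, ← WithZero.exp_zsmul]; simp [WithZero.exp_log hx']
  · rw [hv, ← WithZero.exp_nsmul]
    rw [show ((p : K)) = algebraMap (𝓞 K) K (p : 𝓞 K) from (map_natCast _ p).symm,
      w.valuation_of_algebraMap, valp w p]
    simp
  · exact Ideal.ramificationIdx_pos _ _
  · exact Ideal.inertiaDeg_pos _ _
  · intro x hx
    obtain ⟨a, ha⟩ := exists_approx w hx
    set q := p ^ (w.asIdeal.inertiaDeg ℤ)
    have h1 : w.valuation K (algebraMap (𝓞 K) K (a ^ q - a)) < 1 :=
      (w.valuation_lt_one_iff_mem _).2 (hfr a)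
    have h2 : w.valuation K (algebraMap (𝓞 K) K a ^ q - x ^ q) < 1 := pow_sub_lt w hx ha q

    have : x ^ q - x = algebraMap (𝓞 K) K (a ^ q - a) - (algebraMap (𝓞 K) K a ^ q - x ^ q)
        + (algebraMap (𝓞 K) K a - x) := by simp only [map_sub, map_pow]; ring
    rw [this]
    exact Valuation.map_add_lt _ (Valuation.map_sub_lt _ h1 h2) ha


open scoped Pointwise

lemma smul_val_le (w : HeightOneSpectrum (𝓞 K)) (σ : Gal(K/ℚ)) (h : σ • w.asIdeal = w.asIdeal)
    (a : 𝓞 K) : w.intValuation (σ • a) ≤ w.intValuation a := by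
  by_cases ha : a = 0
  · simp [ha]
  rw [w.intValuation_eq_exp_neg_multiplicity ha, w.intValuation_le_pow_iff_mem]
  have : a ∈ w.asIdeal ^ multiplicity w.asIdeal (Ideal.span {a}) := by
    rw [← w.intValuation_le_pow_iff_mem, w.intValuation_eq_exp_neg_multiplicity ha]
  have h2 := Ideal.smul_mem_pointwise_smul σ _ _ this
  have h3 : σ • (w.asIdeal ^ multiplicity w.asIdeal (Ideal.span {a})) =
      (w.asIdeal ^ multiplicity w.asIdeal (Ideal.span {a})) := by
    rw [smul_pow', h]
  rwa [h3] at h2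

lemma smul_val (w : HeightOneSpectrum (𝓞 K)) (σ : Gal(K/ℚ)) (h : σ • w.asIdeal = w.asIdeal)
    (a : 𝓞 K) : w.intValuation (σ • a) = w.intValuation a := by
  refine le_antisymm (smul_val_le w σ h a) ?_
  have := smul_val_le w σ⁻¹ (by rw [inv_smul_eq_iff, h]) (σ • a)
  rwa [inv_smul_smul] at this

lemma alg_smul (σ : Gal(K/ℚ)) (a : 𝓞 K) :
    algebraMap (𝓞 K) K (σ • a) = σ (algebraMap (𝓞 K) K a) := rfl

lemma smul_valK (w : HeightOneSpectrum (𝓞 K)) (σ : Gal(K/ℚ)) (h : σ • w.asIdeal = w.asIdeal)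
    (x : K) : w.valuation K (σ x) = w.valuation K x := by
  obtain ⟨a, b, hb, rfl⟩ := IsFractionRing.div_surjective (A := 𝓞 K) x
  rw [map_div₀ σ, map_div₀, map_div₀, ← alg_smul, ← alg_smul]
  simp only [w.valuation_of_algebraMap, smul_val w σ h]

/-- The inertia group as a group of ring automorphisms. -/
noncomputable def InR (w : HeightOneSpectrum (𝓞 K)) : Subgroup (RingAut K) :=
  (w.asIdeal.inertia Gal(K/ℚ)).map (MulSemiringAction.toRingAut Gal(K/ℚ) K)

lemma toRingAut_inj : Function.Injective (MulSemiringAction.toRingAut Gal(K/ℚ) K) := by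
  intro σ τ h
  ext x
  exact congrArg (fun f : RingAut K => f x) h

lemma card_InR (w : HeightOneSpectrum (𝓞 K)) :
    Nat.card (InR w) = Nat.card (w.asIdeal.inertia Gal(K/ℚ)) :=
  (Nat.card_congr ((w.asIdeal.inertia Gal(K/ℚ)).equivMapOfInjective _ toRingAut_inj).toEquiv).symm

lemma exists_good (w : HeightOneSpectrum (𝓞 K)) (p : ℕ) [hp : Fact p.Prime]
    [hw : w.asIdeal.LiesOver (Ideal.span {(p : ℤ)})] [IsGalois ℚ K]
    (hab : ∀ σ τ : Gal(K/ℚ), σ * τ = τ * σ)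
    (D : LD K (WithZero (Multiplicative ℤ)) p) (hD : D.v = w.valuation K) :
    ∃ φ, D.Good (InR w) φ := by
  have : IsGaloisGroup Gal(K/ℚ) ℤ (𝓞 K) := IsGaloisGroup.of_isFractionRing _ _ _ ℚ K
  obtain ⟨φ, hφ⟩ := IsArithFrobAt.exists_of_isInvariant ℤ Gal(K/ℚ) w.asIdeal
  have hst : ∀ σ ∈ w.asIdeal.inertia Gal(K/ℚ), σ • w.asIdeal = w.asIdeal := 
    fun σ hσ => Ideal.inertia_le_stabilizer _ hσ
  have hφs : φ • w.asIdeal = w.asIdeal := hφ.mem_stabilizer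
  have hfrb : ∀ a : 𝓞 K, φ • a - a ^ p ∈ w.asIdeal := by
    intro a
    have := hφ a
    rw [← w.asIdeal.over_def (Ideal.span {(p : ℤ)})] at this
    have hc : Nat.card (ℤ ⧸ Ideal.span {(p : ℤ)}) = p := by
      have := Int.ideal_span_absNorm_eq_self
      have h2 : Ideal.absNorm (Ideal.span {(p : ℤ)}) = p := by simp
      rwa [Ideal.absNorm_apply] at h2
    rw [hc] at this
    exact this
  refine ⟨MulSemiringAction.toRingAut Gal(K/ℚ) K φ, ?_, ?_, ?_, ?_, ?_, ?_, ?_⟩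
  · have : 0 < Nat.card (InR w) := by rw [card_InR]; exact Nat.card_pos
    exact Nat.finite_of_card_ne_zero this.ne'
  · rintro _ ⟨σ, hσ, rfl⟩ x
    rw [hD]; exact smul_valK w σ (hst σ hσ) x
  · rintro _ ⟨σ, hσ, rfl⟩ x hx
    rw [D.V0_iff, hD] at hx
    rw [zero_add, D.V1_iff, hD]
    obtain ⟨a, ha⟩ := exists_approx w hx
    have h1 : w.valuation K (algebraMap (𝓞 K) K (σ • a - a)) < 1 :=
      (w.valuation_lt_one_iff_mem _).2 (hσ a)
    have h2 : w.valuation K (σ (algebraMap (𝓞 K) K a - x)) < 1 := by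
      rwa [smul_valK w σ (hst σ hσ)]
    have : (MulSemiringAction.toRingAut Gal(K/ℚ) K σ) x - x = 
        algebraMap (𝓞 K) K (σ • a - a) - σ (algebraMap (𝓞 K) K a - x)
         + (algebraMap (𝓞 K) K a - x) := by
      rw [map_sub, map_sub, alg_smul]
      change σ x - x = _
      ring
    rw [this]
    exact Valuation.map_add_lt _ (Valuation.map_sub_lt _ h1 h2) ha
  · intro x
    rw [hD]; exact smul_valK w φ hφs x
  · intro x hx
    rw [D.V0_iff, hD] at hx
    rw [D.V1_iff, hD]
    obtain ⟨a, ha⟩ := exists_approx w hx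
    have h1 : w.valuation K (algebraMap (𝓞 K) K (φ • a - a ^ p)) < 1 :=
      (w.valuation_lt_one_iff_mem _).2 (hfrb a)
    have h2 : w.valuation K (φ (algebraMap (𝓞 K) K a - x)) < 1 := by
      rwa [smul_valK w φ hφs]
    have h3 := pow_sub_lt w hx ha p
    have : (MulSemiringAction.toRingAut Gal(K/ℚ) K φ) x - x ^ p = 
        algebraMap (𝓞 K) K (φ • a - a ^ p) - φ (algebraMap (𝓞 K) K a - x)
         + (algebraMap (𝓞 K) K a ^ p - x ^ p) := by
      rw [map_sub, map_sub, alg_smul, map_pow]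
      change φ x - x ^ p = _
      ring
    rw [this]
    exact Valuation.map_add_lt _ (Valuation.map_sub_lt _ h1 h2) h3
  · rintro _ ⟨σ, hσ, rfl⟩
    rw [← map_mul, hab, map_mul]
  · rintro _ ⟨σ, hσ, rfl⟩ _ ⟨τ, hτ, rfl⟩
    rw [← map_mul, hab, map_mul]

lemma perf {R : Type*} [CommRing R] (p : Ideal R) [p.IsMaximal] [Finite (R ⧸ p)] :
    PerfectField p.ResidueField := by
  have : Finite p.ResidueField :=
    Finite.of_surjective _ (Ideal.bijective_algebraMap_quotient_residueField p).2
  infer_instance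

lemma card_inertia (w : HeightOneSpectrum (𝓞 K)) [IsGalois ℚ K] :
    Nat.card (w.asIdeal.inertia Gal(K/ℚ)) = w.asIdeal.ramificationIdx ℤ := by
  have : IsGaloisGroup Gal(K/ℚ) ℤ (𝓞 K) := IsGaloisGroup.of_isFractionRing _ _ _ ℚ K
  have h0 : w.asIdeal.under ℤ ≠ ⊥ := Ideal.under_ne_bot _ w.ne_bot
  have : (w.asIdeal.under ℤ).IsMaximal := Ideal.IsPrime.isMaximal inferInstance h0
  have : Finite (ℤ ⧸ w.asIdeal.under ℤ) := Ideal.finiteQuotientOfFreeOfNeBot _ h0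
  have := perf (w.asIdeal.under ℤ)
  rw [Ideal.card_inertia_eq_ramificationIdxIn (G := Gal(K/ℚ)) (w.asIdeal.under ℤ) w.asIdeal,
    Ideal.ramificationIdxIn_eq_ramificationIdx (w.asIdeal.under ℤ) w.asIdeal Gal(K/ℚ)]

end ldsec
end AB

end

section
open NumberField IsDedekindDomain

namespace AB

section diffsec
variable {F K : Type*} [Field F] [NumberField F] [Field K] [NumberField K] [Algebra F K]
  [IsGalois F K]

lemma totally (w : HeightOneSpectrum (𝓞 K))
    (hin : ∀ (σ : Gal(K/F)) (a : 𝓞 K), σ • a - a ∈ w.asIdeal) :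
    ((w.asIdeal.under (𝓞 F)).primesOver (𝓞 K)).ncard = 1 ∧ w.asIdeal.inertiaDeg (𝓞 F) = 1 := by
  have : IsGaloisGroup Gal(K/F) (𝓞 F) (𝓞 K) := IsGaloisGroup.of_isFractionRing _ _ _ F K
  have h0 : w.asIdeal.under (𝓞 F) ≠ ⊥ := Ideal.under_ne_bot _ w.ne_bot
  have : (w.asIdeal.under (𝓞 F)).IsMaximal := Ideal.IsPrime.isMaximal inferInstance h0
  have : Finite (𝓞 F ⧸ w.asIdeal.under (𝓞 F)) := Ideal.finiteQuotientOfFreeOfNeBot _ h0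
  have := perf (w.asIdeal.under (𝓞 F))
  have h := Ideal.ncard_primesOver_mul_card_inertia_mul_finrank (G := Gal(K/F))
    (w.asIdeal.under (𝓞 F)) w.asIdeal
  have htop : w.asIdeal.inertia Gal(K/F) = ⊤ := by
    rw [eq_top_iff]; intro σ _ a; exact hin σ a
  rw [htop, Subgroup.card_top] at h
  have hpos : 0 < Nat.card Gal(K/F) := Nat.card_pos
  have h1 : ((w.asIdeal.under (𝓞 F)).primesOver (𝓞 K)).ncard * w.asIdeal.inertiaDeg (𝓞 F) = 1 := by
    apply Nat.eq_of_mul_eq_mul_right hpos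
    linarith
  exact mul_eq_one.1 h1

lemma exists_lift (w : HeightOneSpectrum (𝓞 K)) (h : w.asIdeal.inertiaDeg (𝓞 F) = 1) (a : 𝓞 K) :
    ∃ b : 𝓞 F, a - algebraMap (𝓞 F) (𝓞 K) b ∈ w.asIdeal := by
  have h0 : w.asIdeal.under (𝓞 F) ≠ ⊥ := Ideal.under_ne_bot _ w.ne_bot
  have hm : (w.asIdeal.under (𝓞 F)).IsMaximal := Ideal.IsPrime.isMaximal inferInstance h0
  rw [Ideal.inertiaDeg_eq_of_isMaximal (w.asIdeal.under (𝓞 F)) w.asIdeal] at h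
  let := Ideal.Quotient.field (w.asIdeal.under (𝓞 F))
  have h1 : (1 : 𝓞 K ⧸ w.asIdeal) ≠ 0 := one_ne_zero
  obtain ⟨c, hc⟩ := (finrank_eq_one_iff_of_nonzero' _ h1).1 h (Ideal.Quotient.mk _ a)
  obtain ⟨b, rfl⟩ := Ideal.Quotient.mk_surjective c
  refine ⟨b, ?_⟩
  rw [← Ideal.Quotient.eq, ← hc, Algebra.smul_def, mul_one]
  rfl

lemma mem_adjoin_sup (w : HeightOneSpectrum (𝓞 K)) (h : w.asIdeal.inertiaDeg (𝓞 F) = 1)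
    {π : 𝓞 K} (hπ : w.intValuation π = WithZero.exp (-1)) (m : ℕ) (a : 𝓞 K) :
    ∃ b ∈ Algebra.adjoin (𝓞 F) {π}, a - b ∈ w.asIdeal ^ m := by
  induction m with
  | zero => exact ⟨0, zero_mem _, by simp⟩
  | succ m ih =>
    obtain ⟨b, hb, hab⟩ := ih
    have hpm : w.intValuation (π ^ m) = WithZero.exp (-(m : ℤ)) := by
      rw [map_pow, hπ, ← WithZero.exp_nsmul]; simp
    rw [← w.intValuation_le_pow_iff_mem, ← hpm] at hab
    obtain ⟨y, hy⟩ := w.exists_intValuation_mul_sub_lt hab (Multiplicative.ofAdd (-(m : ℤ)))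
    have hy' : a - b - y * π ^ m ∈ w.asIdeal ^ (m + 1) := by
      rw [← w.intValuation_le_pow_iff_mem]
      have : w.intValuation (a - b - y * π ^ m) < WithZero.exp (-(m : ℤ)) := hy
      by_cases h0 : w.intValuation (a - b - y * π ^ m) = 0
      · rw [h0]; exact zero_le
      · rw [← WithZero.exp_log h0] at this ⊢
        rw [WithZero.exp_lt_exp] at this
        rw [WithZero.exp_le_exp]
        push_cast; omega
    obtain ⟨c, hc⟩ := exists_lift w h y
    refine ⟨b + algebraMap _ _ c * π ^ m, ?_, ?_⟩
    · exact add_mem hb (mul_mem (Subalgebra.algebraMap_mem _ _)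
        (pow_mem (Algebra.self_mem_adjoin_singleton _ _) _))
    · have : a - (b + algebraMap _ _ c * π ^ m) = (a - b - y * π ^ m)
          + (y - algebraMap _ _ c) * π ^ m := by ring
      rw [this]
      refine add_mem hy' ?_
      rw [pow_succ']
      refine Ideal.mul_mem_mul hc (Ideal.pow_mem_pow ?_ m)
      rw [← pow_one w.asIdeal, ← w.intValuation_le_pow_iff_mem, hπ]; simp

lemma exists_conductor (w : HeightOneSpectrum (𝓞 K))
    (hin : ∀ (σ : Gal(K/F)) (a : 𝓞 K), σ • a - a ∈ w.asIdeal)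
    {π : 𝓞 K} (hπ : w.intValuation π = WithZero.exp (-1)) :
    ∃ r : 𝓞 F, algebraMap (𝓞 F) (𝓞 K) r ∉ w.asIdeal ∧
      ∀ a : 𝓞 K, algebraMap (𝓞 F) (𝓞 K) r * a ∈ Algebra.adjoin (𝓞 F) {π} := by
  obtain ⟨h1, h2⟩ := totally w hin
  set q := w.asIdeal.under (𝓞 F) with hq
  have h0 : q ≠ ⊥ := Ideal.under_ne_bot _ w.ne_bot
  have hmx : q.IsMaximal := Ideal.IsPrime.isMaximal inferInstance h0
  have hrad : (q.map (algebraMap (𝓞 F) (𝓞 K))).radical = w.asIdeal := by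
    rw [Ideal.radical_eq_sInf]
    apply le_antisymm
    · exact sInf_le ⟨Ideal.map_comap_le, w.isPrime⟩
    · refine le_sInf ?_
      rintro J ⟨hJ, hJp⟩
      have hJq : J.LiesOver q := by
        constructor
        refine hmx.eq_of_le (Ideal.IsPrime.ne_top inferInstance) ?_
        rw [Ideal.under_def]
        exact Ideal.map_le_iff_le_comap.1 hJ
      obtain ⟨Q, hQ⟩ := Set.ncard_eq_one.1 h1
      have hJ1 : J ∈ q.primesOver (𝓞 K) := ⟨hJp, hJq⟩
      have hP1 : w.asIdeal ∈ q.primesOver (𝓞 K) := ⟨w.isPrime, ⟨rfl⟩⟩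
      rw [hQ] at hJ1 hP1
      rw [Set.mem_singleton_iff] at hJ1 hP1
      rw [hJ1, hP1]
  obtain ⟨m, hm⟩ := Ideal.exists_radical_pow_le_of_fg (q.map (algebraMap (𝓞 F) (𝓞 K)))
    (IsNoetherian.noetherian _)
  rw [hrad] at hm
  obtain ⟨r, hr, hr'⟩ := Submodule.exists_sub_one_mem_and_smul_le_of_fg_of_le_sup (R := 𝓞 F)
    (I := q) (N := Subalgebra.toSubmodule (Algebra.adjoin (𝓞 F) {π})) (N' := ⊤) (P := ⊤)
    (Module.Finite.fg_top) le_rfl (by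
      intro a _
      obtain ⟨b, hb, hab⟩ := mem_adjoin_sup w h2 hπ m a
      rw [Submodule.mem_sup]
      refine ⟨b, hb, a - b, ?_, by ring⟩
      have := hm hab
      rw [Ideal.smul_top_eq_map]
      exact this)
  refine ⟨r, ?_, ?_⟩
  · intro hr2
    have hr3 : r ∈ q := hr2
    have : (1 : 𝓞 F) ∈ q := by
      have := sub_mem hr3 hr; simpa using this
    exact hmx.ne_top ((Ideal.eq_top_iff_one _).2 this)
  · intro a
    have := hr' (Submodule.smul_mem_pointwise_smul a r ⊤ trivial)
    rw [Algebra.smul_def] at this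
    exact this

lemma adjoin_top {π : 𝓞 K} {r : 𝓞 F} (hr0 : r ≠ 0)
    (hr : ∀ a : 𝓞 K, algebraMap (𝓞 F) (𝓞 K) r * a ∈ Algebra.adjoin (𝓞 F) {π}) :
    Algebra.adjoin F {algebraMap (𝓞 K) K π} = ⊤ := by
  rw [← IntermediateField.adjoin_simple_toSubalgebra_of_isAlgebraic (IsAlgebraic.of_finite F _),
    ← IntermediateField.top_toSubalgebra]
  congr 1
  rw [eq_top_iff]
  rintro x -
  have key : ∀ b ∈ Algebra.adjoin (𝓞 F) {π}, algebraMap (𝓞 K) K b ∈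
      IntermediateField.adjoin F {algebraMap (𝓞 K) K π} := by
    intro b hb
    induction hb using Algebra.adjoin_induction with
    | mem x hx =>
      rw [Set.mem_singleton_iff.1 hx]; exact IntermediateField.mem_adjoin_simple_self _ _
    | algebraMap c =>
      rw [← IsScalarTower.algebraMap_apply, IsScalarTower.algebraMap_apply (𝓞 F) F K]
      exact IntermediateField.algebraMap_mem _ _
    | add x y _ _ h1 h2 => rw [map_add]; exact add_mem h1 h2
    | mul x y _ _ h1 h2 => rw [map_mul]; exact mul_mem h1 h2
  obtain ⟨a, b, hb, rfl⟩ := IsFractionRing.div_surjective (A := 𝓞 K) x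
  have hrr : algebraMap (𝓞 K) K (algebraMap (𝓞 F) (𝓞 K) r) ≠ 0 := by
    rw [← IsScalarTower.algebraMap_apply]
    simpa using hr0
  rw [← mul_div_mul_left _ _ hrr, ← map_mul, ← map_mul]
  exact div_mem (key _ (hr a)) (key _ (hr b))

open scoped Classical in
lemma deriv_minpoly {x : K} (hx : Algebra.adjoin F {x} = ⊤) :
    Polynomial.aeval x (Polynomial.derivative (minpoly F x)) =
      ∏ σ ∈ (Finset.univ : Finset Gal(K/F)).erase 1, (x - σ x) := by
  classical
  have hintg : IsIntegral F x := Algebra.IsIntegral.isIntegral x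
  have hinj : Function.Injective (fun σ : Gal(K/F) => σ x) := by
    intro σ τ h
    have : (σ : K →ₐ[F] K) = τ := by
      apply AlgHom.ext_of_adjoin_eq_top hx
      rintro y hy
      rw [Set.mem_singleton_iff.1 hy]; exact h
    ext y
    exact congrArg (fun f : K →ₐ[F] K => f y) this
  have hspl : ((minpoly F x).map (algebraMap F K)).Splits := Normal.splits inferInstance x
  set f := (minpoly F x).map (algebraMap F K) with hf
  have hdeg : (minpoly F x).natDegree = Module.finrank F K := by
    rw [← IntermediateField.adjoin.finrank hintg]
    have : IntermediateField.adjoin F {x} = ⊤ := by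
      rw [← IntermediateField.toSubalgebra_inj, IntermediateField.top_toSubalgebra,
        IntermediateField.adjoin_simple_toSubalgebra_of_isAlgebraic (IsAlgebraic.of_finite F _), hx]
    rw [this, IntermediateField.finrank_top']
  have hroots : f.roots = (Finset.univ.val : Multiset Gal(K/F)).map (fun σ => σ x) := by
    symm
    apply Multiset.eq_of_le_of_card_le
    · rw [Multiset.le_iff_subset (Multiset.Nodup.map hinj Finset.univ.nodup)]
      intro y hy
      obtain ⟨σ, -, rfl⟩ := Multiset.mem_map.1 hy
      rw [Polynomial.mem_roots ((minpoly.monic hintg).map _).ne_zero, Polynomial.IsRoot.def,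
        Polynomial.eval_map_algebraMap]
      change Polynomial.aeval ((σ : K →ₐ[F] K) x) _ = 0
      rw [Polynomial.aeval_algHom_apply, minpoly.aeval, map_zero]
    · rw [Multiset.card_map]
      refine (Polynomial.card_roots' f).trans ?_
      rw [hf, Polynomial.natDegree_map, hdeg, Finset.card_val, Finset.card_univ,
        ← Nat.card_eq_fintype_card, IsGalois.card_aut_eq_finrank]
  have hmem : x ∈ f.roots := by
    rw [hroots]; exact Multiset.mem_map.2 ⟨1, Finset.mem_univ_val _, rfl⟩
  have hd := Polynomial.Splits.eval_root_derivative hspl ((minpoly.monic hintg).map _) hmem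
  rw [← Polynomial.eval_map_algebraMap, ← Polynomial.derivative_map, hd, hroots,
    Finset.prod_eq_multiset_prod, Finset.erase_val]
  have h1 : (Multiset.map (fun σ : Gal(K/F) => σ x) Finset.univ.val).erase x =
      Multiset.map (fun σ : Gal(K/F) => σ x) (Finset.univ.val.erase 1) := by
    rw [Multiset.map_erase _ hinj]; rfl
  rw [h1, Multiset.map_map]
  rfl

lemma diff_of_prod (w : HeightOneSpectrum (𝓞 K))
    (hin : ∀ (σ : Gal(K/F)) (a : 𝓞 K), σ • a - a ∈ w.asIdeal)
    {π : 𝓞 K} (hπ : w.intValuation π = WithZero.exp (-1)) (σ : Gal(K/F))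
    (hσ : ∀ τ, τ ∈ Subgroup.zpowers σ) {N : ℕ} (hN : orderOf σ = N) {d : ℕ}
    (hd : ∏ i ∈ (Finset.range N).erase 0, ((σ ^ i) • π - π) ∈ w.asIdeal ^ d) :
    w.asIdeal ^ d ∣ differentIdeal (𝓞 F) (𝓞 K) := by
  classical
  obtain ⟨r, hr, hr'⟩ := exists_conductor w hin hπ
  have hr0 : r ≠ 0 := by rintro rfl; simp at hr
  have hadj := adjoin_top hr0 hr'
  have hc := conductor_mul_differentIdeal (𝓞 F) F K π hadj
  have hintg : IsIntegral (𝓞 F) π := Algebra.IsIntegral.isIntegral π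
  have hmem : Polynomial.aeval π (Polynomial.derivative (minpoly (𝓞 F) π)) ∈ w.asIdeal ^ d := by
    have hm := minpoly.isIntegrallyClosed_eq_field_fractions F K hintg
    have h1 := deriv_minpoly hadj
    rw [hm, Polynomial.derivative_map, Polynomial.aeval_map_algebraMap,
      Polynomial.aeval_algebraMap_apply] at h1
    have h2 : ∏ τ ∈ (Finset.univ : Finset Gal(K/F)).erase 1,
        (algebraMap (𝓞 K) K π - τ (algebraMap (𝓞 K) K π)) =
        ∏ i ∈ (Finset.range N).erase 0, 
          (algebraMap (𝓞 K) K π - (σ ^ i) (algebraMap (𝓞 K) K π)) := by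
      symm
      refine Finset.prod_bij (fun i _ => σ ^ i) ?_ ?_ ?_ ?_
      · intro i hi
        rw [Finset.mem_erase, Finset.mem_range] at hi
        rw [Finset.mem_erase]
        refine ⟨fun h => ?_, Finset.mem_univ _⟩
        have := orderOf_dvd_of_pow_eq_one h
        rw [hN] at this
        exact absurd (Nat.le_of_dvd (Nat.pos_of_ne_zero hi.1) this) (by omega)
      · intro i hi j hj h
        rw [Finset.mem_erase, Finset.mem_range, ← hN] at hi hj
        exact pow_injOn_Iio_orderOf hi.2 hj.2 h
      · intro τ hτ
        rw [Finset.mem_erase] at hτ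
        obtain ⟨i, hi, rfl⟩ := Finset.mem_image.1
          ((isOfFinOrder_of_finite σ).mem_powers_iff_mem_range_orderOf.1
          ((isOfFinOrder_of_finite σ).mem_powers_iff_mem_zpowers.2 (hσ τ)))
        refine ⟨i, ?_, rfl⟩
        rw [Finset.mem_erase]
        refine ⟨?_, hN ▸ hi⟩
        rintro rfl
        exact hτ.1 (pow_zero σ)
      · intro i hi; rfl
    have h3 : ∏ i ∈ (Finset.range N).erase 0, 
          (algebraMap (𝓞 K) K π - (σ ^ i) (algebraMap (𝓞 K) K π)) =
          algebraMap (𝓞 K) K (∏ i ∈ (Finset.range N).erase 0, (π - (σ ^ i) • π)) := by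
      rw [map_prod]; rfl
    rw [h2, h3] at h1
    rw [IsFractionRing.injective (𝓞 K) K h1]
    have h4 : ∏ i ∈ (Finset.range N).erase 0, (π - (σ ^ i) • π) = 
        ∏ i ∈ (Finset.range N).erase 0, (-1 * ((σ ^ i) • π - π)) :=
      Finset.prod_congr rfl fun i _ => by ring
    rw [h4, Finset.prod_mul_distrib]
    exact Ideal.mul_mem_left _ _ hd
  have hdvd : w.asIdeal ^ d ∣ conductor (𝓞 F) π * differentIdeal (𝓞 F) (𝓞 K) := by
    rw [hc, Ideal.dvd_span_singleton]; exact hmem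
  refine (w.prime).pow_dvd_of_dvd_mul_left d ?_ hdvd
  intro h
  exact hr (Ideal.dvd_iff_le.1 h hr')

end diffsec
end AB

end

section
open NumberField IsDedekindDomain

namespace AB

section cycsec
variable {K : Type*} [Field K] [NumberField K] [IsGalois ℚ K]

lemma tameK (w : HeightOneSpectrum (𝓞 K)) (p : ℕ) [hp : Fact p.Prime]
    [hw : w.asIdeal.LiesOver (Ideal.span {(p : ℤ)})]
    (hab : ∀ σ τ : Gal(K/ℚ), σ * τ = τ * σ) :
    ∃ e0 k, Nat.card (w.asIdeal.inertia Gal(K/ℚ)) = e0 * p ^ k ∧ e0 + 1 ≤ p := by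
  obtain ⟨D, hD, he, hv, π, hπ⟩ := exists_LD w p
  obtain ⟨φ, g⟩ := exists_good w p hab D hD
  obtain ⟨e0, k, h1, h2, -⟩ := g.tame
  exact ⟨e0, k, by rw [← card_InR, h1], h2⟩

lemma InR_pow (w : HeightOneSpectrum (𝓞 K)) {m : ℕ}
    (hx : ∀ x ∈ w.asIdeal.inertia Gal(K/ℚ), x ^ m = 1) : ∀ x ∈ InR w, x ^ m = 1 := by
  rintro _ ⟨σ, hσ, rfl⟩
  rw [← map_pow, hx σ hσ, map_one]

lemma rankK_odd (w : HeightOneSpectrum (𝓞 K)) (p : ℕ) [hp : Fact p.Prime]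
    [hw : w.asIdeal.LiesOver (Ideal.span {(p : ℤ)})]
    (hab : ∀ σ τ : Gal(K/ℚ), σ * τ = τ * σ) (hp3 : 3 ≤ p)
    (hI : Nat.card (w.asIdeal.inertia Gal(K/ℚ)) = p ^ 2)
    (hx : ∀ x ∈ w.asIdeal.inertia Gal(K/ℚ), x ^ p = 1) : False := by
  obtain ⟨D, hD, he, hv, π, hπ⟩ := exists_LD w p
  obtain ⟨φ, g⟩ := exists_good w p hab D hD
  exact g.rank_odd hp3 (by rw [he, ← card_inertia, hI]) (by rw [card_InR, hI]) (InR_pow w hx)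

lemma rankK_two (w : HeightOneSpectrum (𝓞 K)) 
    [hw : w.asIdeal.LiesOver (Ideal.span {((2 : ℕ) : ℤ)})]
    (hab : ∀ σ τ : Gal(K/ℚ), σ * τ = τ * σ)
    (hI : Nat.card (w.asIdeal.inertia Gal(K/ℚ)) = 8)
    (hx : ∀ x ∈ w.asIdeal.inertia Gal(K/ℚ), x ^ 2 = 1) : False := by
  obtain ⟨D, hD, he, hv, π, hπ⟩ := exists_LD w 2
  obtain ⟨φ, g⟩ := exists_good w 2 hab D hD
  exact g.rank_two (by rw [he, ← card_inertia, hI]) (by rw [card_InR, hI]) (InR_pow w hx)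

lemma diff_of_V (w : HeightOneSpectrum (𝓞 K)) {p : ℕ} (D : LD K (WithZero (Multiplicative ℤ)) p)
    (hD : D.v = w.valuation K) (hv : D.v D.ϖ = WithZero.exp (-1)) {π : 𝓞 K}
    (hπ : algebraMap (𝓞 K) K π = D.ϖ) {σ : Gal(K/ℚ)}
    (hσ : σ ∈ w.asIdeal.inertia Gal(K/ℚ)) {N : ℕ}
    (hI : Nat.card (w.asIdeal.inertia Gal(K/ℚ)) = N) (ho : orderOf σ = N) {d : ℕ}
    (hd : D.V d (∏ i ∈ (Finset.range N).erase 0,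
      (((MulSemiringAction.toRingAut Gal(K/ℚ) K σ) ^ i) D.ϖ - D.ϖ))) :
    w.asIdeal ^ d ∣ differentIdeal ℤ (𝓞 K) := by
  have vA : ∀ a : 𝓞 K, w.valuation K (algebraMap (𝓞 K) K a) = w.intValuation a :=
    fun a => w.valuation_of_algebraMap a
  let F := IntermediateField.fixedField (w.asIdeal.inertia Gal(K/ℚ))
  have hfix : F.fixingSubgroup = w.asIdeal.inertia Gal(K/ℚ) :=
    IntermediateField.fixingSubgroup_fixedField _
  have hσF : σ ∈ F.fixingSubgroup := by rw [hfix]; exact hσ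
  let E := IntermediateField.fixingSubgroupEquiv F
  have hin : ∀ (τ : Gal(K/F)) (a : 𝓞 K), τ • a - a ∈ w.asIdeal := by
    intro τ a
    have h1 : ((E.symm τ : F.fixingSubgroup) : Gal(K/ℚ)) ∈ w.asIdeal.inertia Gal(K/ℚ) := by
      rw [← hfix]; exact (E.symm τ).2
    exact h1 a
  have hintg : w.intValuation π = WithZero.exp (-1) := by
    rw [← vA, hπ, ← hD, hv]
  have ho' : orderOf (E ⟨σ, hσF⟩) = N := by
    rw [MulEquiv.orderOf_eq, Subgroup.orderOf_mk, ho]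
  have hcard : Nat.card Gal(K/F) = N := by
    rw [← Nat.card_congr E.toEquiv, hfix, hI]
  have hgen : ∀ τ : Gal(K/F), τ ∈ Subgroup.zpowers (E ⟨σ, hσF⟩) := by
    intro τ
    rw [Subgroup.eq_top_of_card_eq (Subgroup.zpowers (E ⟨σ, hσF⟩))
      (by rw [Nat.card_zpowers, ho', hcard])]
    trivial
  have key := diff_of_prod w hin hintg _ hgen ho' (d := d) (by
    rw [← w.intValuation_le_pow_iff_mem, ← vA, map_prod]
    have h1 : ∀ i, algebraMap (𝓞 K) K ((E ⟨σ, hσF⟩ ^ i) • π - π) =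
        ((MulSemiringAction.toRingAut Gal(K/ℚ) K σ) ^ i) D.ϖ - D.ϖ := by
      intro i
      rw [← map_pow, ← map_pow, map_sub, ← hπ]
      rfl
    simp only [h1]
    rw [← hD]
    have h2 := hd
    unfold LD.V LD.q at h2
    rw [hv] at h2
    refine h2.trans (le_of_eq ?_)
    simp [← WithZero.exp_zsmul])
  rw [differentIdeal_eq_differentIdeal_mul_differentIdeal ℤ (𝓞 F) (𝓞 K)]
  exact Dvd.dvd.mul_right key _

lemma toRingAut_order (σ : Gal(K/ℚ)) :
    orderOf (MulSemiringAction.toRingAut Gal(K/ℚ) K σ) = orderOf σ :=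
  orderOf_injective _ toRingAut_inj σ

lemma cycK_odd (w : HeightOneSpectrum (𝓞 K)) (p : ℕ) [hp : Fact p.Prime]
    [hw : w.asIdeal.LiesOver (Ideal.span {(p : ℤ)})]
    (hab : ∀ σ τ : Gal(K/ℚ), σ * τ = τ * σ) (hp3 : 3 ≤ p) {k : ℕ} (hk1 : 1 ≤ k)
    (hI : Nat.card (w.asIdeal.inertia Gal(K/ℚ)) = p ^ k) {σ : Gal(K/ℚ)}
    (hσ : σ ∈ w.asIdeal.inertia Gal(K/ℚ)) (ho : orderOf σ = p ^ k) :
    ∃ d, 2 * (k + 1) * p ^ k ≤ 3 * d ∧ w.asIdeal ^ d ∣ differentIdeal ℤ (𝓞 K) := by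
  obtain ⟨D, hD, he, hv, π, hπ⟩ := exists_LD w p
  obtain ⟨φ, g⟩ := exists_good w p hab D hD
  obtain ⟨d, h1, h2⟩ := g.cyc_odd hp3 hk1 (by rw [card_InR, hI])
    (Subgroup.mem_map_of_mem _ hσ) (by rw [toRingAut_order, ho])
  exact ⟨d, h1, diff_of_V w D hD hv hπ hσ hI ho h2⟩

lemma cycK_two (w : HeightOneSpectrum (𝓞 K))
    [hw : w.asIdeal.LiesOver (Ideal.span {((2 : ℕ) : ℤ)})]
    (hab : ∀ σ τ : Gal(K/ℚ), σ * τ = τ * σ) {k : ℕ}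
    (hI : Nat.card (w.asIdeal.inertia Gal(K/ℚ)) = 2 ^ k) {σ : Gal(K/ℚ)}
    (hσ : σ ∈ w.asIdeal.inertia Gal(K/ℚ)) (ho : orderOf σ = 2 ^ k) :
    ∃ d, k * 2 ^ k ≤ d ∧ w.asIdeal ^ d ∣ differentIdeal ℤ (𝓞 K) := by
  obtain ⟨D, hD, he, hv, π, hπ⟩ := exists_LD w 2
  obtain ⟨φ, g⟩ := exists_good w 2 hab D hD
  obtain ⟨d, h1, h2⟩ := g.cyc_two (by rw [card_InR, hI])
    (Subgroup.mem_map_of_mem _ hσ) (by rw [toRingAut_order, ho])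
  exact ⟨d, h1, diff_of_V w D hD hv hπ hσ hI ho h2⟩

end cycsec
end AB

end

section
open NumberField IsDedekindDomain

namespace AB
universe u
section quotsec
variable {K : Type u} [Field K] [NumberField K] [IsGalois ℚ K]
variable (L : Type u) [Field L] [NumberField L] [Algebra L K]

/-- restriction of a prime to a subfield -/
noncomputable def rest (w : HeightOneSpectrum (𝓞 K)) :
    HeightOneSpectrum (𝓞 L) :=
  ⟨w.asIdeal.under (𝓞 L), inferInstance, Ideal.under_ne_bot _ w.ne_bot⟩

instance (w : HeightOneSpectrum (𝓞 K)) :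
    w.asIdeal.LiesOver (rest L w).asIdeal := ⟨rfl⟩

lemma rest_over (w : HeightOneSpectrum (𝓞 K)) (p : ℕ)
    (h : w.asIdeal.LiesOver (Ideal.span {(p : ℤ)})) :
    (rest L w).asIdeal.LiesOver (Ideal.span {(p : ℤ)}) := by
  constructor
  rw [h.over]
  exact (Ideal.under_under _).symm

variable [IsGalois ℚ L]

/-- restriction of automorphisms -/
noncomputable def psi : Gal(K/ℚ) →* Gal(L/ℚ) := AlgEquiv.restrictNormalHom L

lemma psi_apply (σ : Gal(K/ℚ)) (x : L) :
    algebraMap L K (psi L σ x) = σ (algebraMap L K x) :=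
  AlgEquiv.restrictNormal_commutes σ L x

lemma psi_surj : Function.Surjective (psi (K := K) L) :=
  AlgEquiv.restrictNormalHom_surjective (F := ℚ) (K₁ := L) K

lemma card_psi_ker : Nat.card (psi (K := K) L).ker = Nat.card Gal(K/L) := by
  have : IsGalois L K := IsGalois.tower_top_of_isGalois ℚ L K
  have h1 := Subgroup.card_mul_index (psi (K := K) L).ker
  rw [Subgroup.index_ker, (MonoidHom.range_eq_top.2 (psi_surj L)), Subgroup.card_top,
    IsGalois.card_aut_eq_finrank ℚ L, IsGalois.card_aut_eq_finrank ℚ K,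
    ← Module.finrank_mul_finrank ℚ L K, mul_comm] at h1
  rw [IsGalois.card_aut_eq_finrank L K]
  exact Nat.eq_of_mul_eq_mul_left Module.finrank_pos h1

lemma ram_rest (w : HeightOneSpectrum (𝓞 K))
    (hL : (psi L).ker ≤ w.asIdeal.inertia Gal(K/ℚ)) :
    w.asIdeal.ramificationIdx (𝓞 L) = Nat.card (psi (K := K) L).ker := by
  have : IsGalois L K := IsGalois.tower_top_of_isGalois ℚ L K
  have : IsGaloisGroup Gal(K/L) (𝓞 L) (𝓞 K) := IsGaloisGroup.of_isFractionRing _ _ _ L K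
  have := perf (rest L w).asIdeal
  have h1 : w.asIdeal.inertia Gal(K/L) = ⊤ := by
    rw [eq_top_iff]
    intro τ _ a
    have hτ : τ.restrictScalars ℚ ∈ (psi (K := K) L).ker := by
      rw [MonoidHom.mem_ker]
      ext x
      apply (algebraMap L K).injective
      rw [psi_apply]
      exact τ.commutes x
    exact hL hτ a
  have h2 := Ideal.card_inertia_eq_ramificationIdxIn (G := Gal(K/L)) (rest L w).asIdeal w.asIdeal
  rw [Ideal.ramificationIdxIn_eq_ramificationIdx (rest L w).asIdeal w.asIdeal Gal(K/L), h1,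
    Subgroup.card_top] at h2
  rw [← h2, card_psi_ker]

lemma map_inertia (w : HeightOneSpectrum (𝓞 K))
    (hL : (psi L).ker ≤ w.asIdeal.inertia Gal(K/ℚ)) :
    (w.asIdeal.inertia Gal(K/ℚ)).map (psi L) =
      (rest L w).asIdeal.inertia Gal(L/ℚ) := by
  have hle : (w.asIdeal.inertia Gal(K/ℚ)).map (psi L) ≤
      (rest L w).asIdeal.inertia Gal(L/ℚ) := by
    rintro _ ⟨σ, hσ, rfl⟩ a
    change algebraMap (𝓞 L) (𝓞 K) _ ∈ w.asIdeal
    have : algebraMap (𝓞 L) (𝓞 K) (psi L σ • a - a) =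
        σ • (algebraMap (𝓞 L) (𝓞 K) a) - algebraMap (𝓞 L) (𝓞 K) a := by
      rw [map_sub]
      congr 1
      apply RingOfIntegers.ext
      exact psi_apply L σ a
    erw [this]
    exact hσ _
  refine Subgroup.eq_of_le_of_card_ge hle ?_
  have h1 := card_inertia w
  have h2 := card_inertia (rest L w)
  have h3 := Ideal.ramificationIdx_tower (R := ℤ) (rest L w).asIdeal w.asIdeal
  rw [ram_rest L w hL, ← h1, ← h2] at h3
  have h4 := Subgroup.relIndex_ker (w.asIdeal.inertia Gal(K/ℚ)) (psi L)
  have h5 := LD.card_mul_relIndex' hL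
  rw [h4, h3, mul_comm] at h5
  have hpos : 0 < Nat.card (psi (K := K) L).ker := Nat.card_pos
  exact (Nat.eq_of_mul_eq_mul_right hpos h5).ge

lemma diff_rest (w : HeightOneSpectrum (𝓞 K))
    (hL : (psi L).ker ≤ w.asIdeal.inertia Gal(K/ℚ)) (d : ℕ)
    (hd : (rest L w).asIdeal ^ d ∣ differentIdeal ℤ (𝓞 L)) :
    w.asIdeal ^ (Nat.card (psi (K := K) L).ker * d) ∣ differentIdeal ℤ (𝓞 K) := by
  rw [differentIdeal_eq_differentIdeal_mul_differentIdeal ℤ (𝓞 L) (𝓞 K)]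
  refine Dvd.dvd.mul_left ?_ _
  have h0 : (rest L w).asIdeal.map (algebraMap (𝓞 L) (𝓞 K)) ≠ ⊥ :=
    Ideal.map_ne_bot_of_ne_bot (rest L w).ne_bot
  have h1 : w.asIdeal ^ (Nat.card (psi (K := K) L).ker) ∣
      (rest L w).asIdeal.map (algebraMap (𝓞 L) (𝓞 K)) := by
    rw [← ram_rest L w hL,
      Ideal.IsDedekindDomain.ramificationIdx_eq_multiplicity (rest L w).asIdeal w.asIdeal h0]
    exact pow_multiplicity_dvd _ _
  have h2 := pow_dvd_pow_of_dvd h1 d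
  rw [← pow_mul, ← Ideal.map_pow] at h2
  refine h2.trans ?_
  rw [Ideal.dvd_iff_le] at hd ⊢
  exact Ideal.map_mono hd

end quotsec

section quotsec2
variable {K : Type u} [Field K] [NumberField K] [IsGalois ℚ K]

lemma quotK (w : HeightOneSpectrum (𝓞 K)) (hab : ∀ σ τ : Gal(K/ℚ), σ * τ = τ * σ)
    (H : Subgroup Gal(K/ℚ)) (hH : H ≤ w.asIdeal.inertia Gal(K/ℚ)) :
    ∃ (L : Type u) (_ : Field L) (_ : NumberField L) (_ : IsGalois ℚ L)
      (w' : HeightOneSpectrum (𝓞 L)) (ψ : Gal(K/ℚ) →* Gal(L/ℚ)),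
      Function.Surjective ψ ∧ (w.asIdeal.inertia Gal(K/ℚ)).map ψ = w'.asIdeal.inertia Gal(L/ℚ) ∧
      ψ.ker = H ∧ (∀ p : ℕ, w.asIdeal.LiesOver (Ideal.span {(p : ℤ)}) →
        w'.asIdeal.LiesOver (Ideal.span {(p : ℤ)})) ∧
      ∀ d, w'.asIdeal ^ d ∣ differentIdeal ℤ (𝓞 L) →
        w.asIdeal ^ (Nat.card H * d) ∣ differentIdeal ℤ (𝓞 K) := by
  have hN : H.Normal := ⟨fun a ha g => by rwa [hab g a, mul_inv_cancel_right]⟩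
  have hfix : (IntermediateField.fixedField H).fixingSubgroup = H :=
    IntermediateField.fixingSubgroup_fixedField _
  let L := IntermediateField.fixedField H
  have hG : @IsGalois ℚ _ L _ DivisionRing.toRatAlgebra := by
    convert IsGalois.of_fixedField_normal_subgroup H
    exact Subsingleton.elim _ _
  have hker : (psi (K := K) L).ker = H := by
    rw [← hfix]
    ext σ
    rw [MonoidHom.mem_ker, IntermediateField.mem_fixingSubgroup_iff]
    constructor
    · intro h x hx
      have := psi_apply L σ ⟨x, hx⟩
      rw [h] at this
      exact this.symm
    · intro h
      ext x
      exact (psi_apply L σ x).trans (h x x.2)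
  have hL : (psi L).ker ≤ w.asIdeal.inertia Gal(K/ℚ) := by
    rw [hker]; exact hH
  refine ⟨L, inferInstance, inferInstance, hG, rest _ w, psi L,
    psi_surj L, map_inertia _ w hL, hker, rest_over _ w, ?_⟩
  · intro d hd
    have := diff_rest _ w hL d hd
    rwa [hker] at this

end quotsec2
end AB

end

section
open NumberField IsDedekindDomain

namespace AB

lemma cast_surj {a b : ℕ} [NeZero a] (h : a ∣ b) :
    Function.Surjective (AddMonoidHom.toMultiplicative (ZMod.castHom h (ZMod a)).toAddMonoidHom) :=
  ZMod.ringHom_surjective (ZMod.castHom h (ZMod a))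

lemma grp {G : Type*} [CommGroup G] [Finite G] (p : ℕ) [hp : Fact p.Prime] (r : ℕ) :
    (∃ f : G →* (Fin (r + 1) → Multiplicative (ZMod p)), Function.Surjective f) ∨
    ∃ a, (∃ f : G →* Multiplicative (ZMod (p ^ a)), Function.Surjective f) ∧
      ∀ k, p ^ k ∣ Nat.card G → k ≤ r * a := by
  classical
  obtain ⟨ι, hι, n, hn, ⟨E⟩⟩ := CommGroup.equiv_prod_multiplicative_zmod_of_finite G
  let S : Finset ι := Finset.univ.filter fun i => p ∣ n i
  by_cases hS : r + 1 ≤ S.card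
  · left
    obtain ⟨T, hT, hTc⟩ := Finset.exists_subset_card_eq hS
    let j : Fin (r + 1) ≃ T := (Finset.equivFinOfCardEq hTc).symm
    have hTd : ∀ i ∈ T, p ∣ n i := fun i hi => (Finset.mem_filter.1 (hT hi)).2
    have hj : ∀ m, p ∣ n (j m) := fun m => hTd _ (j m).2
    let F : (∀ i, Multiplicative (ZMod (n i))) →* (Fin (r + 1) → Multiplicative (ZMod p)) :=
      MonoidHom.pi fun m => (AddMonoidHom.toMultiplicative
        (ZMod.castHom (hj m) (ZMod p)).toAddMonoidHom).comp (Pi.evalMonoidHom _ (j m : ι))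
    refine ⟨F.comp E.toMonoidHom, ?_⟩
    have : Function.Surjective F := by
      intro y
      have hz : ∀ i, ∃ z : Multiplicative (ZMod (n i)), ∀ h : i ∈ T,
          AddMonoidHom.toMultiplicative (ZMod.castHom (hTd i h) (ZMod p)).toAddMonoidHom z =
            y (j.symm ⟨i, h⟩) := by
        intro i
        by_cases h : i ∈ T
        · obtain ⟨z, hz⟩ := cast_surj (hTd i h) (y (j.symm ⟨i, h⟩))
          exact ⟨z, fun _ => hz⟩
        · exact ⟨1, fun h' => absurd h' h⟩
      choose z hz using hz
      refine ⟨z, ?_⟩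
      funext m
      refine (hz (j m) (j m).2).trans ?_
      simp
    exact this.comp E.surjective
  · right
    push Not at hS
    let a := Finset.univ.sup fun i => (n i).factorization p
    have hcard : Nat.card G = ∏ i, n i := by
      rw [Nat.card_congr E.toEquiv, Nat.card_pi]
      exact Finset.prod_congr rfl fun i _ => by
        rw [Nat.card_congr Multiplicative.toAdd, Nat.card_zmod]
    have hn0 : ∀ i, n i ≠ 0 := fun i => by have := hn i; omega
    refine ⟨a, ?_, ?_⟩
    · by_cases ha : a = 0
      · rw [ha, pow_zero]
        refine ⟨1, fun y => ⟨1, Subsingleton.elim _ _⟩⟩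
      · have hne : (Finset.univ : Finset ι).Nonempty := by
          by_contra h
          rw [Finset.not_nonempty_iff_eq_empty] at h
          exact ha (by simp only [a]; rw [h]; rfl)
        obtain ⟨i, -, hi⟩ := Finset.exists_mem_eq_sup _ hne fun i => (n i).factorization p
        have hd : p ^ a ∣ n i := by
          simp only [a]; rw [hi]; exact Nat.ordProj_dvd _ _
        have : NeZero (p ^ a) := ⟨pow_ne_zero _ hp.out.ne_zero⟩
        exact ⟨((AddMonoidHom.toMultiplicative (ZMod.castHom hd (ZMod (p ^ a))).toAddMonoidHom).comp
          (Pi.evalMonoidHom _ i)).comp E.toMonoidHom, 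
          ((cast_surj hd).comp (Function.surjective_eval i)).comp E.surjective⟩
    · intro k hk
      rw [hcard, hp.out.pow_dvd_iff_le_factorization (Finset.prod_ne_zero_iff.2 fun i _ => hn0 i),
        Nat.factorization_prod fun i _ => hn0 i, Finsupp.finsetSum_apply] at hk
      refine hk.trans ?_
      have h1 : ∑ i, (n i).factorization p = ∑ i ∈ S, (n i).factorization p := by
        symm
        apply Finset.sum_subset (Finset.subset_univ _)
        intro i _ hi
        exact Nat.factorization_eq_zero_of_not_dvd fun h => 
          hi (Finset.mem_filter.2 ⟨Finset.mem_univ _, h⟩)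
      rw [h1]
      calc _ ≤ S.card • a := Finset.sum_le_card_nsmul _ _ _ fun i _ =>
            Finset.le_sup (f := fun i => (n i).factorization p) (Finset.mem_univ i)
        _ ≤ r * a := by
            rw [smul_eq_mul]; exact Nat.mul_le_mul_right _ (by omega)

end AB

end

section
open NumberField IsDedekindDomain

namespace AB
universe u
section primesec
variable {K : Type u} [Field K] [NumberField K] [IsGalois ℚ K]

lemma quot2 (w : HeightOneSpectrum (𝓞 K)) (hab : ∀ σ τ : Gal(K/ℚ), σ * τ = τ * σ)
    {Q : Type*} [Group Q] (f : w.asIdeal.inertia Gal(K/ℚ) →* Q) (hf : Function.Surjective f) :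
    ∃ (L : Type u) (_ : Field L) (_ : NumberField L) (_ : IsGalois ℚ L)
      (w' : HeightOneSpectrum (𝓞 L)) (ψ : Gal(K/ℚ) →* Gal(L/ℚ)),
      (∀ σ τ : Gal(L/ℚ), σ * τ = τ * σ) ∧
      (∀ x ∈ w'.asIdeal.inertia Gal(L/ℚ), ∃ y : w.asIdeal.inertia Gal(K/ℚ), ψ y = x) ∧
      (∀ y : w.asIdeal.inertia Gal(K/ℚ), ψ y ∈ w'.asIdeal.inertia Gal(L/ℚ)) ∧
      (∀ y : w.asIdeal.inertia Gal(K/ℚ), ψ y = 1 ↔ f y = 1) ∧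
      Nat.card (w'.asIdeal.inertia Gal(L/ℚ)) = Nat.card Q ∧
      (∀ p : ℕ, w.asIdeal.LiesOver (Ideal.span {(p : ℤ)}) →
        w'.asIdeal.LiesOver (Ideal.span {(p : ℤ)})) ∧
      ∃ c, Nat.card (w.asIdeal.inertia Gal(K/ℚ)) = c * Nat.card Q ∧
      ∀ d, w'.asIdeal ^ d ∣ differentIdeal ℤ (𝓞 L) →
        w.asIdeal ^ (c * d) ∣ differentIdeal ℤ (𝓞 K) := by
  let H : Subgroup Gal(K/ℚ) := f.ker.map (Subgroup.subtype _)
  have hH : H ≤ w.asIdeal.inertia Gal(K/ℚ) := Subgroup.map_subtype_le _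
  obtain ⟨L, i1, i2, i3, w', ψ, hs, hm, hk, hp, hd⟩ := quotK w hab H hH
  have hcH : Nat.card H = Nat.card f.ker :=
    (Nat.card_congr (f.ker.equivMapOfInjective _ (Subgroup.subtype_injective _)).toEquiv).symm
  have hcI : Nat.card (w.asIdeal.inertia Gal(K/ℚ)) = Nat.card H * Nat.card Q := by
    have h1 := Subgroup.card_mul_index f.ker
    rw [Subgroup.index_ker, (MonoidHom.range_eq_top.2 hf), Subgroup.card_top, ← hcH] at h1
    exact h1.symm
  refine ⟨L, i1, i2, i3, w', ψ, ?_, ?_, ?_, ?_, ?_, hp, Nat.card H, hcI, hd⟩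
  · intro σ τ
    obtain ⟨σ, rfl⟩ := hs σ
    obtain ⟨τ, rfl⟩ := hs τ
    rw [← map_mul, hab, map_mul]
  · intro x hx
    rw [← hm] at hx
    obtain ⟨y, hy, rfl⟩ := hx
    exact ⟨⟨y, hy⟩, rfl⟩
  · intro y
    rw [← hm]
    exact ⟨y, y.2, rfl⟩
  · intro y
    rw [← MonoidHom.mem_ker, hk, ← MonoidHom.mem_ker]
    constructor
    · rintro ⟨z, hz, h⟩
      rwa [← Subtype.ext h]
    · intro h; exact ⟨y, h, rfl⟩
  · have h4 := Subgroup.relIndex_ker (w.asIdeal.inertia Gal(K/ℚ)) ψ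
    rw [hm, hk] at h4
    have h5 := LD.card_mul_relIndex' hH
    rw [h4, hcI] at h5
    exact Nat.eq_of_mul_eq_mul_left Nat.card_pos h5

lemma norank_odd (w : HeightOneSpectrum (𝓞 K)) (p : ℕ) [hp : Fact p.Prime]
    [hw : w.asIdeal.LiesOver (Ideal.span {(p : ℤ)})]
    (hab : ∀ σ τ : Gal(K/ℚ), σ * τ = τ * σ) (hp3 : 3 ≤ p)
    (f : w.asIdeal.inertia Gal(K/ℚ) →* (Fin 2 → Multiplicative (ZMod p)))
    (hf : Function.Surjective f) : False := by
  obtain ⟨L, i1, i2, i3, w', ψ, hab', hx, hy, hk, hc, hl, -⟩ := quot2 w hab f hf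
  have := hl p hw
  refine rankK_odd w' p hab' hp3 ?_ ?_
  · rw [hc, Nat.card_pi]; simp
  · intro x h
    obtain ⟨y, rfl⟩ := hx x h
    rw [← map_pow]
    have := (hk (y ^ p)).2 (by
      rw [map_pow]
      funext i
      change Multiplicative.ofAdd (p • Multiplicative.toAdd (f y i)) = Multiplicative.ofAdd 0
      rw [nsmul_eq_mul, CharP.cast_eq_zero, zero_mul])
    exact this

lemma norank_two (w : HeightOneSpectrum (𝓞 K)) 
    [hw : w.asIdeal.LiesOver (Ideal.span {((2 : ℕ) : ℤ)})]
    (hab : ∀ σ τ : Gal(K/ℚ), σ * τ = τ * σ)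
    (f : w.asIdeal.inertia Gal(K/ℚ) →* (Fin 3 → Multiplicative (ZMod 2)))
    (hf : Function.Surjective f) : False := by
  obtain ⟨L, i1, i2, i3, w', ψ, hab', hx, hy, hk, hc, hl, -⟩ := quot2 w hab f hf
  have := hl 2 hw
  refine rankK_two w' hab' ?_ ?_
  · rw [hc, Nat.card_pi]; simp
  · intro x h
    obtain ⟨y, rfl⟩ := hx x h
    rw [← map_pow]
    have := (hk (y ^ 2)).2 (by
      rw [map_pow]
      funext i
      change Multiplicative.ofAdd (2 • Multiplicative.toAdd (f y i)) = Multiplicative.ofAdd 0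
      rw [nsmul_eq_mul, CharP.cast_eq_zero, zero_mul])
    exact this

lemma cyc_quot (w : HeightOneSpectrum (𝓞 K)) (hab : ∀ σ τ : Gal(K/ℚ), σ * τ = τ * σ)
    {m : ℕ} (hm0 : m ≠ 0) (f : w.asIdeal.inertia Gal(K/ℚ) →* Multiplicative (ZMod m))
    (hf : Function.Surjective f) :
    ∃ (L : Type u) (_ : Field L) (_ : NumberField L) (_ : IsGalois ℚ L)
      (w' : HeightOneSpectrum (𝓞 L)) (σ : Gal(L/ℚ)),
      (∀ σ τ : Gal(L/ℚ), σ * τ = τ * σ) ∧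
      Nat.card (w'.asIdeal.inertia Gal(L/ℚ)) = m ∧ σ ∈ w'.asIdeal.inertia Gal(L/ℚ) ∧
      orderOf σ = m ∧
      (∀ p : ℕ, w.asIdeal.LiesOver (Ideal.span {(p : ℤ)}) →
        w'.asIdeal.LiesOver (Ideal.span {(p : ℤ)})) ∧
      ∃ c, Nat.card (w.asIdeal.inertia Gal(K/ℚ)) = c * m ∧
      ∀ d, w'.asIdeal ^ d ∣ differentIdeal ℤ (𝓞 L) →
        w.asIdeal ^ (c * d) ∣ differentIdeal ℤ (𝓞 K) := by
  obtain ⟨L, i1, i2, i3, w', ψ, hab', hx, hy, hk, hc, hl, c, h1, h2⟩ := quot2 w hab f hf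
  have hcm : Nat.card (Multiplicative (ZMod m)) = m := by
    rw [Nat.card_congr Multiplicative.toAdd, Nat.card_zmod]
  rw [hcm] at hc h1
  obtain ⟨g, hg⟩ := hf (Multiplicative.ofAdd 1)
  refine ⟨L, i1, i2, i3, w', ψ g, hab', hc, hy g, ?_, hl, c, h1, h2⟩
  have h3 : orderOf (ψ g) = orderOf (f g) := by
    rw [orderOf_eq_orderOf_iff]
    intro n
    rw [← map_pow, ← map_pow]
    exact hk (g ^ n)
  rw [h3, hg, orderOf_ofAdd_eq_addOrderOf, ZMod.addOrderOf_one]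

lemma claim_two (w : HeightOneSpectrum (𝓞 K)) 
    [hw : w.asIdeal.LiesOver (Ideal.span {((2 : ℕ) : ℤ)})]
    (hab : ∀ σ τ : Gal(K/ℚ), σ * τ = τ * σ) :
    ∃ d : ℕ, w.asIdeal ^ d ∣ differentIdeal ℤ (𝓞 K) ∧
      (1 / 2 : ℝ) * (Nat.card (w.asIdeal.inertia Gal(K/ℚ)) : ℝ) * 
        Real.log (Nat.card (w.asIdeal.inertia Gal(K/ℚ))) ≤ d * Real.log 2 := by
  let : CommGroup (w.asIdeal.inertia Gal(K/ℚ)) :=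
    { (inferInstance : Group (w.asIdeal.inertia Gal(K/ℚ))) with
      mul_comm := fun a b => Subtype.ext (hab a b) }
  obtain ⟨e0, k, he, h0⟩ := tameK w 2 hab
  have hpos : 0 < Nat.card (w.asIdeal.inertia Gal(K/ℚ)) := Nat.card_pos
  have he0 : e0 = 1 := by
    have : e0 ≠ 0 := by rintro rfl; omega
    omega
  rw [he0, one_mul] at he
  rcases grp (G := w.asIdeal.inertia Gal(K/ℚ)) 2 2 with ⟨f, hf⟩ | ⟨a, ⟨f, hf⟩, ha⟩
  · exact (norank_two w hab f hf).elim
  · have hk := ha k (by rw [he])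
    obtain ⟨L, i1, i2, i3, w', σ, hab', hc, hσ, ho, hl, c, h1, h2⟩ :=
      cyc_quot w hab (pow_ne_zero a two_ne_zero) f hf
    have := hl 2 hw
    obtain ⟨d, hd1, hd2⟩ := cycK_two w' hab' hc hσ ho
    refine ⟨c * d, h2 d hd2, ?_⟩
    have h3 : k * 2 ^ k ≤ 2 * (c * d) := by
      rw [← he, h1]
      calc k * (c * 2 ^ a) ≤ (2 * a) * (c * 2 ^ a) := Nat.mul_le_mul_right _ hk
        _ = 2 * (c * (a * 2 ^ a)) := by ring
        _ ≤ _ := by gcongr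
    have h4 : (k : ℝ) * 2 ^ k ≤ 2 * (c * d) := by exact_mod_cast h3
    rw [he]
    push_cast
    rw [Real.log_pow]
    have := Real.log_nonneg (show (1 : ℝ) ≤ 2 by norm_num)
    nlinarith

lemma claim_odd (w : HeightOneSpectrum (𝓞 K)) (p : ℕ) [hp : Fact p.Prime]
    [hw : w.asIdeal.LiesOver (Ideal.span {(p : ℤ)})]
    (hab : ∀ σ τ : Gal(K/ℚ), σ * τ = τ * σ) (hp3 : 3 ≤ p) :
    ∃ d : ℕ, w.asIdeal ^ d ∣ differentIdeal ℤ (𝓞 K) ∧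
      (2 / 3 : ℝ) * (Nat.card (w.asIdeal.inertia Gal(K/ℚ)) : ℝ) * 
        Real.log (Nat.card (w.asIdeal.inertia Gal(K/ℚ))) ≤ d * Real.log p := by
  let : CommGroup (w.asIdeal.inertia Gal(K/ℚ)) :=
    { (inferInstance : Group (w.asIdeal.inertia Gal(K/ℚ))) with
      mul_comm := fun a b => Subtype.ext (hab a b) }
  obtain ⟨e0, k, he, h0⟩ := tameK w p hab
  have hpos : 0 < Nat.card (w.asIdeal.inertia Gal(K/ℚ)) := Nat.card_pos
  have hp3' : (3 : ℝ) ≤ p := by exact_mod_cast hp3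
  rcases grp (G := w.asIdeal.inertia Gal(K/ℚ)) p 1 with ⟨f, hf⟩ | ⟨a, ⟨f, hf⟩, ha⟩
  · exact (norank_odd w p hab hp3 f hf).elim
  · have hk := ha k (by rw [he]; exact dvd_mul_left _ _)
    rw [one_mul] at hk
    by_cases ha0 : a = 0
    · have hk0 : k = 0 := by omega
      rw [hk0, pow_zero, mul_one] at he
      rw [he] at hpos ⊢
      refine ⟨e0 - 1, ?_, ?_⟩
      · have h0 : (Ideal.span {(p : ℤ)}).map (algebraMap ℤ (𝓞 K)) ≠ ⊥ := by
          apply Ideal.map_ne_bot_of_ne_bot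
          simpa using hp.out.ne_zero
        refine pow_sub_one_dvd_differentIdeal ℤ (p := Ideal.span {(p : ℤ)}) w.asIdeal e0 ?_ ?_
        · simpa using hp.out.ne_zero
        · rw [← he, card_inertia, 
            Ideal.IsDedekindDomain.ramificationIdx_eq_multiplicity (Ideal.span {(p : ℤ)}) w.asIdeal h0]
          exact pow_multiplicity_dvd _ _
      · have hlog3 : Real.log 3 ≤ Real.log p := Real.log_le_log (by norm_num) hp3'
        have h32 : 4 * Real.log 2 ≤ 3 * Real.log 3 := by
          have := Real.log_le_log (show (0 : ℝ) < 2 ^ 4 by norm_num)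
            (show (2 : ℝ) ^ 4 ≤ 3 ^ 3 by norm_num)
          rw [Real.log_pow, Real.log_pow] at this
          exact_mod_cast this
        rcases Nat.lt_or_ge e0 3 with h | h
        · interval_cases e0
          · simp
          · norm_num
            linarith
        · have h1 : (e0 : ℝ) ≤ p := by exact_mod_cast (by omega : e0 ≤ p)
          have h3 : (3 : ℝ) ≤ e0 := by exact_mod_cast h
          have h2 := Real.log_le_log (by linarith) h1
          have h4 := Real.log_nonneg (show (1 : ℝ) ≤ e0 by linarith)
          rw [Nat.cast_sub (by omega), Nat.cast_one]
          have h5 : (2 / 3 : ℝ) * e0 ≤ e0 - 1 := by linarith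
          exact mul_le_mul h5 h2 h4 (by linarith)
    obtain ⟨L, i1, i2, i3, w', σ, hab', hc, hσ, ho, hl, c, h1, h2⟩ :=
      cyc_quot w hab (pow_ne_zero a hp.out.ne_zero) f hf
    have := hl p hw
    obtain ⟨d, hd1, hd2⟩ := cycK_odd w' p hab' hp3 (by omega : 1 ≤ a) hc hσ ho
    refine ⟨c * d, h2 d hd2, ?_⟩
    have h3 : 2 * (a + 1) * (c * p ^ a) ≤ 3 * (c * d) := by
      calc 2 * (a + 1) * (c * p ^ a) = c * (2 * (a + 1) * p ^ a) := by ring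
        _ ≤ c * (3 * d) := by gcongr
        _ = _ := by ring
    rw [← h1] at h3
    set e := Nat.card (w.asIdeal.inertia Gal(K/ℚ)) with hedef
    have h4 : 2 * ((a : ℝ) + 1) * e ≤ 3 * (c * d) := by exact_mod_cast h3
    have h5 : e ≤ p ^ (a + 1) := by
      rw [he, pow_succ']
      exact Nat.mul_le_mul (by omega) (Nat.pow_le_pow_right (by omega) hk)
    have h6 : Real.log e ≤ (a + 1) * Real.log p := by
      have h7 : (e : ℝ) ≤ (p : ℝ) ^ (a + 1) := by exact_mod_cast h5
      have := Real.log_le_log (by exact_mod_cast hpos) h7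
      rw [Real.log_pow] at this
      exact_mod_cast this
    have hlp := Real.log_nonneg (show (1 : ℝ) ≤ p by linarith)
    push_cast
    calc (2 / 3 : ℝ) * e * Real.log e ≤ (2 / 3 : ℝ) * e * ((a + 1) * Real.log p) := by gcongr
      _ = (2 * ((a : ℝ) + 1) * e) / 3 * Real.log p := by ring
      _ ≤ (3 * (c * d)) / 3 * Real.log p := by gcongr
      _ = _ := by ring

end primesec
end AB

end

section
open NumberField IsDedekindDomain

namespace AB
universe u
section gensec
variable {K : Type u} [Field K] [NumberField K] [IsGalois ℚ K]

lemma ram_rest_one (L : Type u) [Field L] [NumberField L] [Algebra L K] [IsGalois ℚ L]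
    (w : HeightOneSpectrum (𝓞 K))
    (hI : w.asIdeal.inertia Gal(K/ℚ) ≤ (psi L).ker) :
    (rest L w).asIdeal.ramificationIdx ℤ = 1 := by
  have : IsGalois L K := IsGalois.tower_top_of_isGalois ℚ L K
  have : IsGaloisGroup Gal(K/L) (𝓞 L) (𝓞 K) := IsGaloisGroup.of_isFractionRing _ _ _ L K
  have := perf (rest L w).asIdeal
  have h2 := Ideal.card_inertia_eq_ramificationIdxIn (G := Gal(K/L)) (rest L w).asIdeal w.asIdeal
  rw [Ideal.ramificationIdxIn_eq_ramificationIdx (rest L w).asIdeal w.asIdeal Gal(K/L)] at h2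
  have h3 := Ideal.ramificationIdx_tower (R := ℤ) (rest L w).asIdeal w.asIdeal
  rw [← card_inertia w, ← h2] at h3
  have hfix : ∀ σ : w.asIdeal.inertia Gal(K/ℚ), ∀ x : L,
      (σ : Gal(K/ℚ)) (algebraMap L K x) = algebraMap L K x := by
    intro σ x
    rw [← psi_apply, MonoidHom.mem_ker.1 (hI σ.2)]; rfl
  let F : w.asIdeal.inertia Gal(K/ℚ) → w.asIdeal.inertia Gal(K/L) := fun σ =>
    ⟨AlgEquiv.ofRingEquiv (f := ((σ : Gal(K/ℚ)) : K ≃+* K)) (hfix σ), fun a => σ.2 a⟩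
  have hF : Function.Injective F := by
    intro σ τ h
    apply Subtype.ext
    ext x
    exact congrArg (fun g : w.asIdeal.inertia Gal(K/L) => (g : Gal(K/L)) x) h
  have h4 := Nat.card_le_card_of_injective F hF
  have h5 : 0 < Nat.card (w.asIdeal.inertia Gal(K/L)) := Nat.card_pos
  have h6 : 0 < Nat.card (w.asIdeal.inertia Gal(K/ℚ)) := Nat.card_pos
  have h7 : (rest L w).asIdeal.ramificationIdx ℤ ≠ 0 := by
    intro h; rw [h] at h3; omega
  have h8 : (rest L w).asIdeal.ramificationIdx ℤ * Nat.card (w.asIdeal.inertia Gal(K/L)) ≤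
      1 * Nat.card (w.asIdeal.inertia Gal(K/L)) := by rw [← h3]; simpa using h4
  have := Nat.le_of_mul_le_mul_right h8 h5
  omega

lemma generate (hab : ∀ σ τ : Gal(K/ℚ), σ * τ = τ * σ) (H : Subgroup Gal(K/ℚ))
    (hH : ∀ w : HeightOneSpectrum (𝓞 K), w.asIdeal.inertia Gal(K/ℚ) ≤ H) : H = ⊤ := by
  have hN : H.Normal := ⟨fun a ha g => by rwa [hab g a, mul_inv_cancel_right]⟩
  have hfix : (IntermediateField.fixedField H).fixingSubgroup = H :=
    IntermediateField.fixingSubgroup_fixedField _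
  let L := IntermediateField.fixedField H
  have hG : @IsGalois ℚ _ L _ DivisionRing.toRatAlgebra := by
    convert IsGalois.of_fixedField_normal_subgroup H
    exact Subsingleton.elim _ _
  have hker : (psi (K := K) L).ker = H := by
    rw [← hfix]
    ext σ
    rw [MonoidHom.mem_ker, IntermediateField.mem_fixingSubgroup_iff]
    constructor
    · intro h x hx
      have := psi_apply L σ ⟨x, hx⟩
      rw [h] at this
      exact this.symm
    · intro h
      ext x
      exact (psi_apply L σ x).trans (h x x.2)
  have hone : Module.finrank ℚ L = 1 := by
    by_contra hne
    obtain ⟨P, hP, hPu⟩ := NumberField.exists_not_isUnramifiedAt_int (K := L) (𝒪 := 𝓞 L) hne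
    apply hPu
    obtain ⟨Q, hQ, hQP⟩ := Ideal.exists_maximal_ideal_liesOver_of_isIntegral (S := 𝓞 K) P
    have hQ0 : Q ≠ ⊥ := Ideal.IsMaximal.ne_bot_of_isIntegral_int _
    let w : HeightOneSpectrum (𝓞 K) := ⟨Q, hQ.isPrime, hQ0⟩
    have hP' : P = (rest L w).asIdeal := hQP.over
    have h1 := ram_rest_one L w (by rw [hker]; exact hH w)
    rw [← hP'] at h1
    have h0 : P.under ℤ ≠ ⊥ := Ideal.under_ne_bot _ (Ideal.IsMaximal.ne_bot_of_isIntegral_int _)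
    have : (P.under ℤ).IsMaximal := Ideal.IsPrime.isMaximal inferInstance h0
    have : Finite (ℤ ⧸ P.under ℤ) := Ideal.finiteQuotientOfFreeOfNeBot _ h0
    have := perf (P.under ℤ)
    exact Ideal.ramificationIdx_eq_one_iff.1 h1
  have hc := IsGalois.card_aut_eq_finrank ℚ L
  rw [hone] at hc
  have hsub := (Nat.card_eq_one_iff_unique.1 hc).1
  rw [← hker, eq_top_iff]
  intro σ _
  rw [MonoidHom.mem_ker]
  exact Subsingleton.elim _ _

open scoped Pointwise in
lemma card_sup_le {G : Type*} [Group G] [Finite G] (hab : ∀ σ τ : G, σ * τ = τ * σ)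
    (S : Finset ℕ) (I : ℕ → Subgroup G) :
    Nat.card (S.sup I : Subgroup G) ≤ ∏ p ∈ S, Nat.card (I p) := by
  classical
  induction S using Finset.induction_on with
  | empty => simp
  | insert a S ha ih =>
    rw [Finset.sup_insert, Finset.prod_insert ha]
    have hN : (S.sup I).Normal := ⟨fun a ha g => by rwa [hab g a, mul_inv_cancel_right]⟩
    have h1 : Nat.card ((I a ⊔ S.sup I : Subgroup G)) =
        Nat.card ((I a : Set G) * ((S.sup I : Subgroup G) : Set G) : Set G) := by
      rw [← Subgroup.mul_normal]; rfl
    rw [h1]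
    exact Set.natCard_mul_le.trans (Nat.mul_le_mul_left _ ih)

lemma inertia_le (hab : ∀ σ τ : Gal(K/ℚ), σ * τ = τ * σ) (p : ℕ)
    (w w' : HeightOneSpectrum (𝓞 K))
    (hw : w.asIdeal.LiesOver (Ideal.span {(p : ℤ)}))
    (hw' : w'.asIdeal.LiesOver (Ideal.span {(p : ℤ)})) :
    w.asIdeal.inertia Gal(K/ℚ) ≤ w'.asIdeal.inertia Gal(K/ℚ) := by
  have : IsGaloisGroup Gal(K/ℚ) ℤ (𝓞 K) := IsGaloisGroup.of_isFractionRing _ _ _ ℚ K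
  obtain ⟨τ, hτ⟩ := Ideal.exists_smul_eq_of_isGaloisGroup (Ideal.span {(p : ℤ)}) w.asIdeal
    w'.asIdeal Gal(K/ℚ)
  intro σ hσ b
  change σ • b - b ∈ w'.asIdeal
  rw [← hτ, Ideal.mem_pointwise_smul_iff_inv_smul_mem, smul_sub, smul_smul, hab, ← smul_smul]
  exact hσ (τ⁻¹ • b)

lemma dvd_discr (p : ℕ) [hp : Fact p.Prime] (w : HeightOneSpectrum (𝓞 K))
    [hw : w.asIdeal.LiesOver (Ideal.span {(p : ℤ)})]
    (h : Nat.card (w.asIdeal.inertia Gal(K/ℚ)) ≠ 1) : p ∣ (discr K).natAbs := by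
  have hpos : 0 < Nat.card (w.asIdeal.inertia Gal(K/ℚ)) := Nat.card_pos
  have h0 : (Ideal.span {(p : ℤ)}).map (algebraMap ℤ (𝓞 K)) ≠ ⊥ := by
    apply Ideal.map_ne_bot_of_ne_bot
    simpa using hp.out.ne_zero
  have h1 := pow_sub_one_dvd_differentIdeal ℤ (p := Ideal.span {(p : ℤ)}) w.asIdeal
    (Nat.card (w.asIdeal.inertia Gal(K/ℚ))) (by simpa using hp.out.ne_zero) (by
      rw [card_inertia, 
        Ideal.IsDedekindDomain.ramificationIdx_eq_multiplicity (Ideal.span {(p : ℤ)}) w.asIdeal h0]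
      exact pow_multiplicity_dvd _ _)
  have h2 : w.asIdeal ∣ differentIdeal ℤ (𝓞 K) := (dvd_pow_self _ (by omega)).trans h1
  have h3 := map_dvd Ideal.absNorm h2
  rw [NumberField.absNorm_differentIdeal K, absN w p] at h3
  refine (dvd_pow_self p ?_).trans h3
  intro hf
  have h4 := absN w p
  rw [hf, pow_zero, Ideal.absNorm_eq_one_iff] at h4
  exact w.isPrime.ne_top h4

lemma exists_W : ∃ W : ℕ → HeightOneSpectrum (𝓞 K), ∀ p, p.Prime →
    (W p).asIdeal.LiesOver (Ideal.span {(p : ℤ)}) := by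
  have key : ∀ p : ℕ, p.Prime → ∃ w : HeightOneSpectrum (𝓞 K),
      w.asIdeal.LiesOver (Ideal.span {(p : ℤ)}) := by
    intro p hp
    have := Fact.mk hp
    obtain ⟨Q, hQ, hQP⟩ := Ideal.exists_maximal_ideal_liesOver_of_isIntegral (S := 𝓞 K)
      (Ideal.span {(p : ℤ)})
    exact ⟨⟨Q, hQ.isPrime, Ideal.IsMaximal.ne_bot_of_isIntegral_int _⟩, hQP⟩
  have hne : Nonempty (HeightOneSpectrum (𝓞 K)) := ⟨(key 2 Nat.prime_two).choose⟩
  have : ∀ p : ℕ, ∃ w : HeightOneSpectrum (𝓞 K), p.Prime →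
      w.asIdeal.LiesOver (Ideal.span {(p : ℤ)}) := by
    intro p
    by_cases hp : p.Prime
    · obtain ⟨w, hw⟩ := key p hp
      exact ⟨w, fun _ => hw⟩
    · exact ⟨hne.some, fun h => absurd h hp⟩
  choose W hW using this
  exact ⟨W, hW⟩

lemma exists_p (w : HeightOneSpectrum (𝓞 K)) : ∃ p : ℕ, p.Prime ∧
    w.asIdeal.LiesOver (Ideal.span {(p : ℤ)}) := by
  have h0 : w.asIdeal.under ℤ ≠ ⊥ := Ideal.under_ne_bot _ w.ne_bot
  obtain ⟨p, hp : _ = Ideal.span _⟩ := IsPrincipalIdealRing.principal (w.asIdeal.under ℤ)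
  have hp0 : p ≠ 0 := by rintro rfl; apply h0; rw [hp]; simp
  have hpp : Prime p := by rw [← Ideal.span_singleton_prime hp0, ← hp]; infer_instance
  refine ⟨p.natAbs, Int.prime_iff_natAbs_prime.mp hpp, ⟨?_⟩⟩
  rw [hp, Int.span_natAbs]

lemma degree_le (hab : ∀ σ τ : Gal(K/ℚ), σ * τ = τ * σ) (W : ℕ → HeightOneSpectrum (𝓞 K))
    (hW : ∀ p, p.Prime → (W p).asIdeal.LiesOver (Ideal.span {(p : ℤ)})) :
    Module.finrank ℚ K ≤ 
      ∏ p ∈ (discr K).natAbs.primeFactors, Nat.card ((W p).asIdeal.inertia Gal(K/ℚ)) := by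
  rw [← IsGalois.card_aut_eq_finrank ℚ K]
  refine le_trans ?_ (card_sup_le hab _ fun p => (W p).asIdeal.inertia Gal(K/ℚ))
  rw [generate hab ((discr K).natAbs.primeFactors.sup fun p => (W p).asIdeal.inertia Gal(K/ℚ)),
    Subgroup.card_top]
  intro w
  obtain ⟨p, hp, hw⟩ := exists_p w
  have := Fact.mk hp
  by_cases h1 : Nat.card (w.asIdeal.inertia Gal(K/ℚ)) = 1
  · rw [Subgroup.eq_bot_of_card_eq _ h1]; exact bot_le
  · have h2 := dvd_discr p w h1
    refine (inertia_le hab p w (W p) hw (hW p hp)).trans 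
      (Finset.le_sup (f := fun p => (W p).asIdeal.inertia Gal(K/ℚ)) (Nat.mem_primeFactors.2 
        ⟨hp, h2, ?_⟩))
    exact Int.natAbs_ne_zero.2 (discr_ne_zero K)

end gensec
end AB

end

section
open NumberField IsDedekindDomain

namespace AB
universe u
section finsec
variable {K : Type u} [Field K] [NumberField K] [IsGalois ℚ K]

/-- the exponent constant at `p` -/
noncomputable def xp (p : ℕ) : ℝ := if p = 2 then 1 / 2 else 2 / 3

lemma claim_p (w : HeightOneSpectrum (𝓞 K)) (p : ℕ) (hp : p.Prime)
    (hw : w.asIdeal.LiesOver (Ideal.span {(p : ℤ)}))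
    (hab : ∀ σ τ : Gal(K/ℚ), σ * τ = τ * σ) :
    ∃ d : ℕ, w.asIdeal ^ d ∣ differentIdeal ℤ (𝓞 K) ∧
      xp p * (Nat.card (w.asIdeal.inertia Gal(K/ℚ)) : ℝ) * 
        Real.log (Nat.card (w.asIdeal.inertia Gal(K/ℚ))) ≤ d * Real.log p := by
  have := Fact.mk hp
  unfold xp
  by_cases h2 : p = 2
  · subst h2
    simpa using claim_two w hab
  · rw [if_neg h2]
    exact claim_odd w p hab (by have := hp.two_le; omega)

lemma card_inertia_In (w : HeightOneSpectrum (𝓞 K)) (p : ℕ)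
    (hw : w.asIdeal.LiesOver (Ideal.span {(p : ℤ)})) :
    Nat.card (w.asIdeal.inertia Gal(K/ℚ)) = (Ideal.span {(p : ℤ)}).ramificationIdxIn (𝓞 K) := by
  have : IsGaloisGroup Gal(K/ℚ) ℤ (𝓞 K) := IsGaloisGroup.of_isFractionRing _ _ _ ℚ K
  rw [card_inertia, 
    Ideal.ramificationIdxIn_eq_ramificationIdx (Ideal.span {(p : ℤ)}) w.asIdeal Gal(K/ℚ)]

lemma absN_In (w : HeightOneSpectrum (𝓞 K)) (p : ℕ)
    (hw : w.asIdeal.LiesOver (Ideal.span {(p : ℤ)})) :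
    Ideal.absNorm w.asIdeal = p ^ ((Ideal.span {(p : ℤ)}).inertiaDegIn (𝓞 K)) := by
  have : IsGaloisGroup Gal(K/ℚ) ℤ (𝓞 K) := IsGaloisGroup.of_isFractionRing _ _ _ ℚ K
  rw [absN w p, 
    Ideal.inertiaDegIn_eq_inertiaDeg (Ideal.span {(p : ℤ)}) w.asIdeal Gal(K/ℚ)]

/-- product of prime powers over one rational prime -/
lemma exists_Ap (p : ℕ) (hp : p.Prime) (hab : ∀ σ τ : Gal(K/ℚ), σ * τ = τ * σ) :
    ∃ A : Ideal (𝓞 K), A ∣ differentIdeal ℤ (𝓞 K) ∧ 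
      (∃ m : ℕ, Ideal.absNorm A = p ^ m) ∧
      (Module.finrank ℚ K : ℝ) * (xp p * Real.log ((Ideal.span {(p : ℤ)}).ramificationIdxIn (𝓞 K)))
        ≤ Real.log (Ideal.absNorm A) := by
  classical
  have hfp := Fact.mk hp
  have : IsGaloisGroup Gal(K/ℚ) ℤ (𝓞 K) := IsGaloisGroup.of_isFractionRing _ _ _ ℚ K
  have hpz : Prime (p : ℤ) := Nat.prime_iff_prime_int.1 hp
  have hp0 : Ideal.span {(p : ℤ)} ≠ ⊥ := by simpa using hp.ne_zero
  have hpr : (Ideal.span {(p : ℤ)}).IsPrime := (Ideal.span_singleton_prime hpz.ne_zero).2 hpz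
  set e := (Ideal.span {(p : ℤ)}).ramificationIdxIn (𝓞 K) with he
  set f := (Ideal.span {(p : ℤ)}).inertiaDegIn (𝓞 K) with hf
  have hn := Ideal.ncard_primesOver_mul_ramificationIdxIn_mul_inertiaDegIn 
    (Ideal.span {(p : ℤ)}) (𝓞 K) Gal(K/ℚ)
  rw [← he, ← hf, IsGalois.card_aut_eq_finrank] at hn
  have hfin : ((Ideal.span {(p : ℤ)}).primesOver (𝓞 K)).Finite := by
    apply Set.finite_of_ncard_ne_zero
    intro h
    rw [h, zero_mul] at hn
    exact (Module.finrank_pos (R := ℚ) (M := K)).ne hn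
  have hmx : ∀ P ∈ (Ideal.span {(p : ℤ)}).primesOver (𝓞 K), 
      ∃ w : HeightOneSpectrum (𝓞 K), w.asIdeal = P := by
    rintro P ⟨hP1, hP2⟩
    refine ⟨⟨P, hP1, ?_⟩, rfl⟩
    rintro rfl
    apply hp0
    rw [hP2.over]
    simp
  have hd : ∀ P : Ideal (𝓞 K), ∃ d : ℕ, P ∈ (Ideal.span {(p : ℤ)}).primesOver (𝓞 K) →
      P ^ d ∣ differentIdeal ℤ (𝓞 K) ∧ xp p * e * Real.log e ≤ d * Real.log p := by
    intro P
    by_cases hP : P ∈ (Ideal.span {(p : ℤ)}).primesOver (𝓞 K)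
    · obtain ⟨w, rfl⟩ := hmx P hP
      obtain ⟨d, h1, h2⟩ := claim_p w p hp hP.2 hab
      rw [card_inertia_In w p hP.2] at h2
      exact ⟨d, fun _ => ⟨h1, h2⟩⟩
    · exact ⟨0, fun h => absurd h hP⟩
  choose d hd using hd
  have hN : Ideal.absNorm (∏ P ∈ hfin.toFinset, P ^ d P) = 
      p ^ (∑ P ∈ hfin.toFinset, f * d P) := by
    rw [map_prod, ← Finset.prod_pow_eq_pow_sum]
    refine Finset.prod_congr rfl fun P hP => ?_
    rw [Set.Finite.mem_toFinset] at hP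
    obtain ⟨w, rfl⟩ := hmx P hP
    rw [map_pow, absN_In w p hP.2, ← pow_mul]
  refine ⟨∏ P ∈ hfin.toFinset, P ^ d P, ?_, ⟨_, hN⟩, ?_⟩
  · apply Finset.prod_dvd_of_coprime
    · intro P hP Q hQ hPQ
      rw [Finset.mem_coe, Set.Finite.mem_toFinset] at hP hQ
      obtain ⟨w, rfl⟩ := hmx P hP
      obtain ⟨w', rfl⟩ := hmx Q hQ
      exact (Ideal.isCoprime_of_isMaximal hPQ).pow
    · intro P hP
      rw [Set.Finite.mem_toFinset] at hP
      exact (hd P hP).1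
  · rw [hN]
    push_cast
    rw [Real.log_pow]
    push_cast
    rw [Finset.sum_mul]
    have h1 : (hfin.toFinset.card : ℝ) * (f * (xp p * e * Real.log e)) ≤ 
        ∑ P ∈ hfin.toFinset, (f : ℝ) * d P * Real.log p := by
      rw [← nsmul_eq_mul]
      apply Finset.card_nsmul_le_sum
      intro P hP
      rw [Set.Finite.mem_toFinset] at hP
      rw [mul_assoc (f : ℝ)]
      exact mul_le_mul_of_nonneg_left (hd P hP).2 (Nat.cast_nonneg _)
    refine le_trans (le_of_eq ?_) h1
    rw [← hn, Set.ncard_eq_toFinset_card _ hfin]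
    push_cast
    ring

lemma discr_ge (hab : ∀ σ τ : Gal(K/ℚ), σ * τ = τ * σ) :
    (Module.finrank ℚ K : ℝ) * (∑ p ∈ (discr K).natAbs.primeFactors, 
      xp p * Real.log ((Ideal.span {(p : ℤ)}).ramificationIdxIn (𝓞 K)))
        ≤ Real.log |(discr K : ℝ)| := by
  have hA : ∀ p : ℕ, ∃ A : Ideal (𝓞 K), p.Prime → (A ∣ differentIdeal ℤ (𝓞 K) ∧ 
      (∃ m : ℕ, Ideal.absNorm A = p ^ m) ∧
      (Module.finrank ℚ K : ℝ) * (xp p * Real.log ((Ideal.span {(p : ℤ)}).ramificationIdxIn (𝓞 K)))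
        ≤ Real.log (Ideal.absNorm A)) := by
    intro p
    by_cases hp : p.Prime
    · obtain ⟨A, h⟩ := exists_Ap (K := K) p hp hab
      exact ⟨A, fun _ => h⟩
    · exact ⟨⊥, fun h => absurd h hp⟩
  choose A hA using hA
  have hd0 : (discr K).natAbs ≠ 0 := Int.natAbs_ne_zero.2 (discr_ne_zero K)
  have hdvd : ∏ p ∈ (discr K).natAbs.primeFactors, Ideal.absNorm (A p) ∣ (discr K).natAbs := by
    apply Finset.prod_dvd_of_isRelPrime
    · intro p hp q hq hpq
      have hp := Nat.prime_of_mem_primeFactors hp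
      have hq := Nat.prime_of_mem_primeFactors hq
      obtain ⟨m, hm⟩ := (hA p hp).2.1
      obtain ⟨k, hk⟩ := (hA q hq).2.1
      change IsRelPrime (Ideal.absNorm (A p)) (Ideal.absNorm (A q))
      rw [hm, hk, ← Nat.coprime_iff_isRelPrime]
      exact Nat.Coprime.pow _ _ ((Nat.coprime_primes hp hq).2 hpq)
    · intro p hp
      have hp := Nat.prime_of_mem_primeFactors hp
      rw [← NumberField.absNorm_differentIdeal K (𝓞 K)]
      exact map_dvd Ideal.absNorm (hA p hp).1
  have hle := Nat.le_of_dvd (Nat.pos_of_ne_zero hd0) hdvd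
  have hpos : ∀ p ∈ (discr K).natAbs.primeFactors, (Ideal.absNorm (A p) : ℝ) ≠ 0 := by
    intro p hp
    have hp := Nat.prime_of_mem_primeFactors hp
    obtain ⟨m, hm⟩ := (hA p hp).2.1
    rw [hm]
    exact_mod_cast pow_ne_zero m hp.ne_zero
  have habs : |(discr K : ℝ)| = ((discr K).natAbs : ℝ) := by
    rw [Nat.cast_natAbs]; simp
  rw [habs]
  have h1 : Real.log (∏ p ∈ (discr K).natAbs.primeFactors, (Ideal.absNorm (A p) : ℝ)) ≤ 
      Real.log ((discr K).natAbs : ℝ) := by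
    apply Real.log_le_log
    · exact Finset.prod_pos fun p hp => lt_of_le_of_ne (Nat.cast_nonneg _) (hpos p hp).symm
    · exact_mod_cast hle
  refine le_trans ?_ h1
  rw [Real.log_prod hpos, Finset.mul_sum]
  exact Finset.sum_le_sum fun p hp => (hA p (Nat.prime_of_mem_primeFactors hp)).2.2

lemma numerics : Real.pi / 2 + (Real.log (8 * Real.pi) + Real.eulerMascheroniConstant) <
    (95 / 12) * Real.log 2 := by
  have h1 := Real.eulerMascheroniConstant_lt_two_thirds
  have h2 := Real.pi_lt_d4
  have h3 := Real.log_two_gt_d9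
  have h0 := Real.pi_pos
  have h4 : 3 * Real.log (8 * Real.pi) ≤ 14 * Real.log 2 := by
    have := Real.log_le_log (show (0 : ℝ) < (8 * Real.pi) ^ 3 by positivity)
      (show (8 * Real.pi) ^ 3 ≤ (2 : ℝ) ^ 14 by
        calc (8 * Real.pi) ^ 3 ≤ (8 * 3.1416) ^ 3 := by gcongr
          _ ≤ _ := by norm_num)
    rw [Real.log_pow, Real.log_pow] at this
    exact_mod_cast this
  linarith

lemma sum_ge (S : Finset ℕ) (e : ℕ → ℕ) (he : ∀ p ∈ S, 1 ≤ e p) (n : ℕ) (hn : 46369 ≤ n)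
    (hle : n ≤ ∏ p ∈ S, e p) (h2 : ∃ k, e 2 = 2 ^ k) :
    (95 / 12) * Real.log 2 ≤ ∑ p ∈ S, xp p * Real.log (e p) := by
  have hl2 := Real.log_two_gt_d9
  have hnn : ∀ p ∈ S, 0 ≤ Real.log (e p) := fun p hp => 
    Real.log_nonneg (by exact_mod_cast he p hp)
  by_cases h : ∃ q ∈ S, q ≠ 2 ∧ 2 ≤ e q
  · obtain ⟨q, hq, hq2, hqe⟩ := h
    have hlogn : (31 / 2) * Real.log 2 ≤ Real.log n := by
      have h1 := Real.log_le_log (show (0 : ℝ) < 2 ^ 31 by norm_num)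
        (show (2 : ℝ) ^ 31 ≤ (46369 : ℝ) ^ 2 by norm_num)
      rw [Real.log_pow, Real.log_pow] at h1
      have h2 := Real.log_le_log (show (0 : ℝ) < 46369 by norm_num)
        (show (46369 : ℝ) ≤ n by exact_mod_cast hn)
      push_cast at h1
      linarith
    have hsum : Real.log n ≤ ∑ p ∈ S, Real.log (e p) := by
      rw [← Real.log_prod fun p hp => by have := he p hp; positivity]
      apply Real.log_le_log
      · exact_mod_cast (by omega : 0 < n)
      · exact_mod_cast hle
    have hqlog : Real.log 2 ≤ Real.log (e q) :=
      Real.log_le_log (by norm_num) (by exact_mod_cast hqe)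
    have h3 : (1 / 6) * Real.log (e q) ≤ ∑ p ∈ S, (xp p - 1 / 2) * Real.log (e p) := by
      have h4 : (1 / 6) * Real.log (e q) = (xp q - 1 / 2) * Real.log (e q) := by
        rw [xp, if_neg hq2]; norm_num
      rw [h4]
      refine Finset.single_le_sum (f := fun p => (xp p - 1 / 2) * Real.log (e p)) ?_ hq
      intro p hp
      refine mul_nonneg ?_ (hnn p hp)
      unfold xp; split_ifs <;> norm_num
    have h5 : ∑ p ∈ S, xp p * Real.log (e p) = ∑ p ∈ S, (xp p - 1 / 2) * Real.log (e p) +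
        (1 / 2) * ∑ p ∈ S, Real.log (e p) := by
      rw [Finset.mul_sum, ← Finset.sum_add_distrib]
      exact Finset.sum_congr rfl fun p _ => by ring
    rw [h5]
    linarith
  · push Not at h
    have h1 : ∀ p ∈ S, p ≠ 2 → e p = 1 := fun p hp hp2 => by
      have := h p hp hp2; have := he p hp; omega
    have h2S : 2 ∈ S := by
      by_contra h2S
      rw [Finset.prod_eq_one fun p hp => h1 p hp (by rintro rfl; exact h2S hp)] at hle
      omega
    rw [Finset.prod_eq_single_of_mem 2 h2S fun p hp hp2 => h1 p hp hp2] at hle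
    obtain ⟨k, hk⟩ := h2
    have hk16 : 16 ≤ k := by
      by_contra hlt
      have : 2 ^ k ≤ 2 ^ 15 := Nat.pow_le_pow_right (by norm_num) (by omega)
      omega
    rw [Finset.sum_eq_single_of_mem 2 h2S fun p hp hp2 => by rw [h1 p hp hp2]; simp, hk]
    unfold xp
    push_cast
    rw [Real.log_pow]
    have : (16 : ℝ) ≤ k := by exact_mod_cast hk16
    nlinarith

lemma final (hab : ∀ σ τ : Gal(K/ℚ), σ * τ = τ * σ) (hn : 46369 ≤ Module.finrank ℚ K) :
    0 < Real.log |(discr K : ℝ)| - (Module.finrank ℚ K : ℝ) * (Real.pi / 2) -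
      (Module.finrank ℚ K : ℝ) * (Real.log (8 * Real.pi) + Real.eulerMascheroniConstant) := by
  obtain ⟨W, hW⟩ := exists_W (K := K)
  have h1 := degree_le hab W hW
  have h2 := discr_ge hab
  have hcard : ∀ p : ℕ, p.Prime → (Ideal.span {(p : ℤ)}).ramificationIdxIn (𝓞 K) =
      Nat.card ((W p).asIdeal.inertia Gal(K/ℚ)) := 
    fun p hp => (card_inertia_In (W p) p (hW p hp)).symm
  have h3 := sum_ge (discr K).natAbs.primeFactors 
    (fun p => Nat.card ((W p).asIdeal.inertia Gal(K/ℚ))) (fun p _ => Nat.card_pos) _ hn h1 (by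
      have := hW 2 Nat.prime_two
      obtain ⟨e0, k, he, h0⟩ := tameK (W 2) 2 hab
      have hpos : 0 < Nat.card ((W 2).asIdeal.inertia Gal(K/ℚ)) := Nat.card_pos
      have he0 : e0 = 1 := by
        have : e0 ≠ 0 := by rintro rfl; omega
        omega
      rw [he0, one_mul] at he
      exact ⟨k, he⟩)
  rw [Finset.sum_congr rfl fun p hp => by 
    rw [hcard p (Nat.prime_of_mem_primeFactors hp)]] at h2
  have h4 := numerics
  have hn0 : (0 : ℝ) < Module.finrank ℚ K := by exact_mod_cast (by omega)
  have h5 := mul_lt_mul_of_pos_left (h4.trans_le h3) hn0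
  linarith

end finsec
end AB

end

/-- Let `K` be an abelian number field of degree `n ≥ 46369`. Then
`log|d_K| − r₁(K)·π/2 − n(log(8π)+γ) > 0`; in particular
`log|d_K| ≠ r₁(K)·π/2 + n(log(8π)+γ)`. -/
theorem abelian_large_degree_log_discr_pos
    (K : Type*) [Field K] [NumberField K] [IsGalois ℚ K]
    (habelian : ∀ σ τ : K ≃ₐ[ℚ] K, σ * τ = τ * σ)
    (hn : 46369 ≤ Module.finrank ℚ K) :
    0 < Real.log |(NumberField.discr K : ℝ)| -
        (NumberField.InfinitePlace.nrRealPlaces K : ℝ) * (Real.pi / 2) -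
        (Module.finrank ℚ K : ℝ) *
          (Real.log (8 * Real.pi) + Real.eulerMascheroniConstant) ∧
    Real.log |(NumberField.discr K : ℝ)| ≠
      (NumberField.InfinitePlace.nrRealPlaces K : ℝ) * (Real.pi / 2) +
        (Module.finrank ℚ K : ℝ) *
          (Real.log (8 * Real.pi) + Real.eulerMascheroniConstant) := by
  have P := AB.final habelian hn
  have h1 := NumberField.InfinitePlace.card_add_two_mul_card_eq_rank K
  have h2 : (NumberField.InfinitePlace.nrRealPlaces K : ℝ) ≤ (Module.finrank ℚ K : ℝ) := by
    exact_mod_cast (by omega :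
      NumberField.InfinitePlace.nrRealPlaces K ≤ Module.finrank ℚ K)
  have h3 : (NumberField.InfinitePlace.nrRealPlaces K : ℝ) * (Real.pi / 2) ≤
      (Module.finrank ℚ K : ℝ) * (Real.pi / 2) :=
    mul_le_mul_of_nonneg_right h2 (by positivity)
  constructor
  · linarith
  · intro h
    linarith
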